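/- arXiv:2506.14283 — 2 statements merged into one kernel-verified Lean document; each statement's English description precedes it below -/
import Mathlib

section
/- Let 1 ≤ p < ∞, let (X,𝒜,μ) be a probability space, let S,T : X → X be commuting, invertible, measure-preserving, ergodic transformations, and let {R_n}_{n∈ℕ} be a process. Then the following are equivalent: (i) for every f ∈ L^p(X), the limit lim_{n→∞} M_n f(x) exists for almost every x ∈ X; (ii) the maximal operator M* is of weak-type (p,p). -/
open MeasureTheory Filter Topology Set
open scoped ENNReal Pointwise BigOperators

noncomputable section

/-- A (possibly tilted) closed rectangle in the plane, described by a corner,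
an angle, and two positive side lengths. -/
structure Rect where
  corner : ℝ × ℝ
  angle : ℝ
  len1 : ℝ
  len2 : ℝ
  len1_pos : 0 < len1
  len2_pos : 0 < len2

namespace Rect

/-- The set of points of a rectangle. -/
def carrier (R : Rect) : Set (ℝ × ℝ) :=
  {p | ∃ s t : ℝ, s ∈ Icc (0 : ℝ) R.len1 ∧ t ∈ Icc (0 : ℝ) R.len2 ∧
    p = R.corner + s • (Real.cos R.angle, Real.sin R.angle) +
      t • (-Real.sin R.angle, Real.cos R.angle)}

/-- `l(R)`: the length of the shortest side. -/
def shortSide (R : Rect) : ℝ := min R.len1 R.len2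

/-- `L(R)`: the length of the longest side. -/
def longSide (R : Rect) : ℝ := max R.len1 R.len2

/-- The slope of a rectangle: the tangent of the angle formed between its longest
side and the horizontal axis (canonical choice for squares). -/
def slope (R : Rect) : ℝ :=
  if R.len2 ≤ R.len1 then Real.tan R.angle else Real.tan (R.angle + Real.pi / 2)

end Rect

/-- The integer lattice points lying in a planar set. -/
def latticePts (F : Set (ℝ × ℝ)) : Set (ℤ × ℤ) := {p | ((p.1 : ℝ), (p.2 : ℝ)) ∈ F}

/-- `#(F ∩ ℤ²)`: the number of integer lattice points in `F`. -/
def latticeCount (F : Set (ℝ × ℝ)) : ℕ := (latticePts F).ncard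

/-- A process: a sequence of rectangles containing `(0,0)` whose shortest sides
tend to infinity. -/
def IsProcess (R : ℕ → Rect) : Prop :=
  (∀ n, ((0 : ℝ), (0 : ℝ)) ∈ (R n).carrier) ∧
    Tendsto (fun n => (R n).shortSide) atTop atTop

variable {X : Type*} [MeasurableSpace X]

/-- The ergodic average `M_R f(x) = (1/#(R ∩ ℤ²)) ∑_{(i,j) ∈ R ∩ ℤ²} f(S^i T^j x)`. -/
def ergAvg (S T : X ≃ᵐ X) (R : Rect) (f : X → ℝ) (x : X) : ℝ :=
  (latticeCount R.carrier : ℝ)⁻¹ *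
    ∑ᶠ p ∈ latticePts R.carrier, f ((S.toEquiv ^ p.1) ((T.toEquiv ^ p.2) x))

/-- The maximal operator `M* f = sup_n M_n |f|`. -/
def maxOp (S T : X ≃ᵐ X) (R : ℕ → Rect) (f : X → ℝ) (x : X) : ℝ≥0∞ :=
  ⨆ n, ENNReal.ofReal (ergAvg S T (R n) (fun y => |f y|) x)

/-- The maximal operator `M'* f = sup_n |M_n f|`. -/
def maxOpAbs (S T : X ≃ᵐ X) (R : ℕ → Rect) (f : X → ℝ) (x : X) : ℝ≥0∞ :=
  ⨆ n, ENNReal.ofReal |ergAvg S T (R n) f x|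

/-- `S, T` form a pair of commuting, invertible, measure-preserving, ergodic
transformations of the probability space `(X, μ)`. -/
structure ErgodicSetup (μ : Measure X) (S T : X ≃ᵐ X) : Prop where
  prob : IsProbabilityMeasure μ
  measPres_S : MeasurePreserving (⇑S) μ μ
  measPres_T : MeasurePreserving (⇑T) μ μ
  comm : ∀ x, S (T x) = T (S x)
  erg_S : Ergodic (⇑S) μ
  erg_T : Ergodic (⇑T) μ

/-- An operator `M` is of weak-type `(p,p)`. -/
def IsWeakType (μ : Measure X) (M : (X → ℝ) → X → ℝ≥0∞) (p : ℝ) : Prop :=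
  ∃ C : ℝ, 0 < C ∧ ∀ f : X → ℝ, MemLp f (ENNReal.ofReal p) μ → ∀ lam : ℝ, 0 < lam →
    μ {x | ENNReal.ofReal lam < M f x} ≤
      ENNReal.ofReal (C * ((eLpNorm f (ENNReal.ofReal p) μ).toReal / lam) ^ p)

/-- The averages `M_n f` converge almost everywhere. -/
def AEConverges (μ : Measure X) (S T : X ≃ᵐ X) (R : ℕ → Rect) (f : X → ℝ) : Prop :=
  ∀ᵐ x ∂μ, ∃ L : ℝ, Tendsto (fun n => ergAvg S T (R n) f x) atTop (𝓝 L)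

/-- The maximal operator `M*` satisfies a Tauberian condition. -/
def ErgTauberian (μ : Measure X) (S T : X ≃ᵐ X) (R : ℕ → Rect) : Prop :=
  ∀ lam : ℝ, 0 < lam → lam < 1 → ∃ C : ℝ, 0 < C ∧ ∀ A : Set X, MeasurableSet A →
    0 < μ A → μ A < ⊤ →
    μ {x | ENNReal.ofReal lam < maxOp S T R (A.indicator fun _ => (1 : ℝ)) x} ≤
      ENNReal.ofReal C * μ A

/-- A `p`-good process: on every probability space with a commuting, invertible,
measure-preserving, ergodic pair, the averages converge a.e. for every `f ∈ L^p`. -/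
def IsGoodProcess (R : ℕ → Rect) (p : ℝ≥0∞) : Prop :=
  ∀ (Y : Type) [MeasurableSpace Y], ∀ (μ : Measure Y) (S T : Y ≃ᵐ Y),
    ErgodicSetup μ S T → ∀ f : Y → ℝ, MemLp f p μ → AEConverges μ S T R f

/-- The discrete average `A_R φ(k,l)`. -/
def discAvg (R : Rect) (φ : ℤ × ℤ → ℝ) (kl : ℤ × ℤ) : ℝ :=
  (latticeCount R.carrier : ℝ)⁻¹ *
    ∑ᶠ p ∈ latticePts R.carrier, φ (kl.1 + p.1, kl.2 + p.2)

/-- The discrete maximal operator `A* φ = sup_n A_n |φ|`. -/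
def discMaxOp (R : ℕ → Rect) (φ : ℤ × ℤ → ℝ) (kl : ℤ × ℤ) : ℝ≥0∞ :=
  ⨆ n, ENNReal.ofReal (discAvg (R n) (fun q => |φ q|) kl)

/-- The `N`-truncated discrete maximal operator `A*_N φ = sup_{n ≥ N} A_n |φ|`. -/
def discMaxOpFrom (R : ℕ → Rect) (N : ℕ) (φ : ℤ × ℤ → ℝ) (kl : ℤ × ℤ) : ℝ≥0∞ :=
  ⨆ n, ⨆ (_ : N ≤ n), ENNReal.ofReal (discAvg (R n) (fun q => |φ q|) kl)

def lpSum (φ : ℤ × ℤ → ℝ) (p : ℝ) : ℝ≥0∞ := ∑' q : ℤ × ℤ, ENNReal.ofReal (|φ q| ^ p)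

/-- `φ ∈ ℓ^p(ℤ²)`. -/
def Memlp (φ : ℤ × ℤ → ℝ) (p : ℝ) : Prop := lpSum φ p < ⊤

/-- The `ℓ^p(ℤ²)` norm. -/
def lpNorm (φ : ℤ × ℤ → ℝ) (p : ℝ) : ℝ≥0∞ := lpSum φ p ^ (1 / p)

/-- The `ℓ^p(ℤ²)` norm of an `ℝ≥0∞`-valued function. -/
def lpNormE (F : ℤ × ℤ → ℝ≥0∞) (p : ℝ) : ℝ≥0∞ := (∑' q : ℤ × ℤ, F q ^ p) ^ (1 / p)

/-- A discrete operator `B` is of weak-type `(p,p)` on `ℓ^p(ℤ²)`. -/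
def IsDiscWeakType (B : (ℤ × ℤ → ℝ) → ℤ × ℤ → ℝ≥0∞) (p : ℝ) : Prop :=
  ∃ C : ℝ, 0 < C ∧ ∀ φ : ℤ × ℤ → ℝ, Memlp φ p → ∀ lam : ℝ, 0 < lam →
    Measure.count {kl : ℤ × ℤ | ENNReal.ofReal lam ≤ B φ kl} ≤
      ENNReal.ofReal (C * ((lpNorm φ p).toReal / lam) ^ p)

/-- The discrete maximal operator associated with `R` satisfies a Tauberian condition. -/
def DiscTauberian (R : ℕ → Rect) : Prop :=
  ∀ lam : ℝ, 0 < lam → ∃ C : ℝ, 0 < C ∧ ∀ E : Finset (ℤ × ℤ), E.Nonempty →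
    Measure.count {kl : ℤ × ℤ |
        ENNReal.ofReal lam ≤ discMaxOp R (fun q => if q ∈ E then (1 : ℝ) else 0) kl} ≤
      ENNReal.ofReal C * (E.card : ℝ≥0∞)

/-- Vertices and sets of the geometric construction 1 (with `A = (1,0)`,
`B = (0,b)`, `C = (0,c)`). -/
def ptA : ℝ × ℝ := (1, 0)
def ptB (b : ℝ) : ℝ × ℝ := (0, b)
def ptC (c : ℝ) : ℝ × ℝ := (0, c)
def ptB' (b : ℝ) : ℝ × ℝ := ptA + (3 / 2 : ℝ) • (ptB b - ptA)
def ptC' (c : ℝ) : ℝ × ℝ := ptA + (3 / 2 : ℝ) • (ptC c - ptA)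

/-- The full triangle `ABC`. -/
def triABC (b c : ℝ) : Set (ℝ × ℝ) := convexHull ℝ {ptA, ptB b, ptC c}

/-- The full trapezium `BCC'B'`. -/
def trapV (b c : ℝ) : Set (ℝ × ℝ) := convexHull ℝ {ptB b, ptC c, ptC' c, ptB' b}

/-- The rectangle `P`: the smallest rectangle having `AC'` as one of its sides and
containing the triangle `AB'C'`, translated so that its center is the origin.
Its sides have directions `(-1,c)/√(1+c²)` and `(c,1)/√(1+c²)`, with half-lengths
`(3/4)√(1+c²)` and `(3/4)(b-c)/√(1+c²)`. -/
def rectP (b c : ℝ) : Set (ℝ × ℝ) :=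
  {p : ℝ × ℝ |
    |(-p.1 + c * p.2)| / Real.sqrt (1 + c ^ 2) ≤ (3 / 4) * Real.sqrt (1 + c ^ 2) ∧
    |(c * p.1 + p.2)| / Real.sqrt (1 + c ^ 2) ≤ (3 / 4) * (b - c) / Real.sqrt (1 + c ^ 2)}

/-- Horizontal translation of a planar set by `t`. -/
def hTranslate (t : ℝ) (F : Set (ℝ × ℝ)) : Set (ℝ × ℝ) :=
  (fun p : ℝ × ℝ => (p.1 + t, p.2)) '' F

/-- The triangle `Δ_k` with vertices `A = (0,1)`, `B_{k-1} = (u_{k-1}, 0)`,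
`B_k = (u_k, 0)`. -/
def triPerron (u : ℕ → ℝ) (k : ℕ) : Set (ℝ × ℝ) :=
  convexHull ℝ {((0 : ℝ), (1 : ℝ)), ((u (k - 1) : ℝ), (0 : ℝ)), ((u k : ℝ), (0 : ℝ))}

/-- The symmetric difference `Δ_n := R_n △ (R_n + (0,1))`. -/
def symmDiffTranslate (R : Rect) : Set (ℝ × ℝ) :=
  symmDiff R.carrier ((fun q : ℝ × ℝ => q + ((0 : ℝ), (1 : ℝ))) '' R.carrier)


lemma Rect.mem_iff (R : Rect) (q : ℝ × ℝ) : q ∈ R.carrier ↔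
    (0 ≤ (q.1 - R.corner.1) * Real.cos R.angle + (q.2 - R.corner.2) * Real.sin R.angle ∧
     (q.1 - R.corner.1) * Real.cos R.angle + (q.2 - R.corner.2) * Real.sin R.angle ≤ R.len1) ∧
    (0 ≤ -(q.1 - R.corner.1) * Real.sin R.angle + (q.2 - R.corner.2) * Real.cos R.angle ∧
     -(q.1 - R.corner.1) * Real.sin R.angle + (q.2 - R.corner.2) * Real.cos R.angle ≤ R.len2) := by
  have hcs := Real.sin_sq_add_cos_sq R.angle
  set c := Real.cos R.angle
  set s := Real.sin R.angle
  constructor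
  · rintro ⟨a, b, ⟨ha0, ha1⟩, ⟨hb0, hb1⟩, rfl⟩
    have e1 : (R.corner.1 + a * c + b * (-s) - R.corner.1) * c
        + (R.corner.2 + a * s + b * c - R.corner.2) * s = a := by
      linear_combination a * hcs
    have e2 : -(R.corner.1 + a * c + b * (-s) - R.corner.1) * s
        + (R.corner.2 + a * s + b * c - R.corner.2) * c = b := by
      linear_combination b * hcs
    simp only [Prod.fst_add, Prod.snd_add, Prod.smul_mk, smul_eq_mul]
    change (0 ≤ (R.corner.1 + a * c + b * (-s) - R.corner.1) * c
        + (R.corner.2 + a * s + b * c - R.corner.2) * s ∧ _) ∧ _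
    rw [e1, e2]
    exact ⟨⟨ha0, ha1⟩, hb0, hb1⟩
  · rintro ⟨h1, h2⟩
    refine ⟨_, _, h1, h2, ?_⟩
    ext
    · simp only [Prod.fst_add, Prod.smul_mk, smul_eq_mul]
      change q.1 = R.corner.1 + _ * c + _ * (-s)
      linear_combination -(q.1 - R.corner.1) * hcs
    · simp only [Prod.snd_add, Prod.smul_mk, smul_eq_mul]
      change q.2 = R.corner.2 + _ * s + _ * c
      linear_combination -(q.2 - R.corner.2) * hcs

lemma rot_bound {x y c s a b : ℝ} (hcs : s ^ 2 + c ^ 2 = 1)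
    (h1 : |x * c + y * s| ≤ a) (h2 : |-x * s + y * c| ≤ b) : |x| ≤ a + b ∧ |y| ≤ a + b := by
  have hc : |c| ≤ 1 := abs_le_one_iff_mul_self_le_one.2 (by nlinarith)
  have hs : |s| ≤ 1 := abs_le_one_iff_mul_self_le_one.2 (by nlinarith)
  have m1 : |(x * c + y * s) * c| ≤ a := by
    rw [abs_mul]; nlinarith [abs_nonneg c, abs_nonneg (x * c + y * s)]
  have m2 : |(x * c + y * s) * s| ≤ a := by
    rw [abs_mul]; nlinarith [abs_nonneg s, abs_nonneg (x * c + y * s)]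
  have m3 : |(-x * s + y * c) * c| ≤ b := by
    rw [abs_mul]; nlinarith [abs_nonneg c, abs_nonneg (-x * s + y * c)]
  have m4 : |(-x * s + y * c) * s| ≤ b := by
    rw [abs_mul]; nlinarith [abs_nonneg s, abs_nonneg (-x * s + y * c)]
  constructor
  · have : x = (x * c + y * s) * c - (-x * s + y * c) * s := by linear_combination -x * hcs
    rw [this]; exact (abs_sub _ _).trans (add_le_add m1 m4)
  · have : y = (x * c + y * s) * s + (-x * s + y * c) * c := by linear_combination -y * hcs
    rw [this]; exact (abs_add_le _ _).trans (add_le_add m2 m3)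

lemma Rect.finite_lattice (R : Rect) : (latticePts R.carrier).Finite := by
  have key : ∀ q ∈ latticePts R.carrier, |(q.1 : ℝ) - R.corner.1| ≤ R.len1 + R.len2 ∧
      |(q.2 : ℝ) - R.corner.2| ≤ R.len1 + R.len2 := by
    intro q hq
    obtain ⟨⟨h1, h2⟩, h3, h4⟩ := (R.mem_iff _).1 hq
    exact rot_bound (Real.sin_sq_add_cos_sq R.angle) (abs_le.2 ⟨by linarith [R.len1_pos], h2⟩)
      (abs_le.2 ⟨by linarith [R.len2_pos], h4⟩)
  refine ((Set.finite_Icc ⌊R.corner.1 - (R.len1 + R.len2)⌋ ⌈R.corner.1 + (R.len1 + R.len2)⌉).prod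
    (Set.finite_Icc ⌊R.corner.2 - (R.len1 + R.len2)⌋ ⌈R.corner.2 + (R.len1 + R.len2)⌉)).subset ?_
  intro q hq
  obtain ⟨h1, h2⟩ := key q hq
  rw [abs_le] at h1 h2
  refine ⟨⟨?_, ?_⟩, ?_, ?_⟩
  · have : (⌊R.corner.1 - (R.len1 + R.len2)⌋ : ℝ) ≤ q.1 := (Int.floor_le _).trans (by linarith)
    exact_mod_cast this
  · have : (q.1 : ℝ) ≤ ⌈R.corner.1 + (R.len1 + R.len2)⌉ := le_trans (by linarith) (Int.le_ceil _)
    exact_mod_cast this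
  · have : (⌊R.corner.2 - (R.len1 + R.len2)⌋ : ℝ) ≤ q.2 := (Int.floor_le _).trans (by linarith)
    exact_mod_cast this
  · have : (q.2 : ℝ) ≤ ⌈R.corner.2 + (R.len1 + R.len2)⌉ := le_trans (by linarith) (Int.le_ceil _)
    exact_mod_cast this

def latF (R : Rect) : Finset (ℤ × ℤ) := R.finite_lattice.toFinset

lemma mem_latF {R : Rect} {q : ℤ × ℤ} : q ∈ latF R ↔ ((q.1 : ℝ), (q.2 : ℝ)) ∈ R.carrier := by
  simp [latF, latticePts]

lemma latticeCount_eq (R : Rect) : latticeCount R.carrier = (latF R).card :=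
  Set.ncard_eq_toFinset_card _ R.finite_lattice

lemma card_lower (R : Rect) : ⌊R.len1 / 2⌋₊ * ⌊R.len2 / 2⌋₊ ≤ (latF R).card := by
  have hcs := Real.sin_sq_add_cos_sq R.angle
  set c := Real.cos R.angle with hcdef
  set s := Real.sin R.angle with hsdef
  let PX : ℕ × ℕ → ℝ := fun i => R.corner.1 + (2 * i.1 + 1) * c - (2 * i.2 + 1) * s
  let PY : ℕ × ℕ → ℝ := fun i => R.corner.2 + (2 * i.1 + 1) * s + (2 * i.2 + 1) * c
  let φ : ℕ × ℕ → ℤ × ℤ := fun i => (round (PX i), round (PY i))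
  have key1 : ∀ i, |((φ i).1 - R.corner.1) * c + ((φ i).2 - R.corner.2) * s - (2 * i.1 + 1)| < 1 := by
    intro i
    have hx := abs_sub_round (PX i)
    have hy := abs_sub_round (PY i)
    have e : ((φ i).1 - R.corner.1) * c + ((φ i).2 - R.corner.2) * s - (2 * i.1 + 1)
      = -((PX i - round (PX i)) * c + (PY i - round (PY i)) * s) := by
      simp only [φ, PX, PY]; linear_combination (2 * (i.1 : ℝ) + 1) * hcs
    rw [e, abs_neg]
    generalize PX i - round (PX i) = u at *
    generalize PY i - round (PY i) = v at *
    have hu : u ^ 2 ≤ 1 / 4 := by rw [← sq_abs]; nlinarith [abs_nonneg u]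
    have hv : v ^ 2 ≤ 1 / 4 := by rw [← sq_abs]; nlinarith [abs_nonneg v]
    refine (sq_lt_one_iff_abs_lt_one _).1 ?_
    have : (u * c + v * s) * (u * c + v * s) + (u * s - v * c) ^ 2 = u ^ 2 + v ^ 2 := by
      linear_combination (u ^ 2 + v ^ 2) * hcs
    nlinarith [sq_nonneg (u * s - v * c)]
  have key2 : ∀ i, |-((φ i).1 - R.corner.1) * s + ((φ i).2 - R.corner.2) * c - (2 * i.2 + 1)| < 1 := by
    intro i
    have hx := abs_sub_round (PX i)
    have hy := abs_sub_round (PY i)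
    have e : -((φ i).1 - R.corner.1) * s + ((φ i).2 - R.corner.2) * c - (2 * i.2 + 1)
      = -(-(PX i - round (PX i)) * s + (PY i - round (PY i)) * c) := by
      simp only [φ, PX, PY]; linear_combination (2 * (i.2 : ℝ) + 1) * hcs
    rw [e, abs_neg]
    generalize PX i - round (PX i) = u at *
    generalize PY i - round (PY i) = v at *
    have hu : u ^ 2 ≤ 1 / 4 := by rw [← sq_abs]; nlinarith [abs_nonneg u]
    have hv : v ^ 2 ≤ 1 / 4 := by rw [← sq_abs]; nlinarith [abs_nonneg v]
    refine (sq_lt_one_iff_abs_lt_one _).1 ?_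
    have : (-u * s + v * c) * (-u * s + v * c) + (u * c + v * s) ^ 2 = u ^ 2 + v ^ 2 := by
      linear_combination (u ^ 2 + v ^ 2) * hcs
    nlinarith [sq_nonneg (u * c + v * s)]
  have := Finset.card_le_card_of_injOn (s := Finset.range ⌊R.len1 / 2⌋₊ ×ˢ Finset.range ⌊R.len2 / 2⌋₊)
    (t := latF R) φ ?_ ?_
  · simpa using this
  · intro i hi
    simp only [Finset.coe_product, Finset.coe_range, Set.mem_prod, Set.mem_Iio] at hi
    have h1 : (i.1 : ℝ) + 1 ≤ R.len1 / 2 := by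
      have := Nat.floor_le (show 0 ≤ R.len1 / 2 by linarith [R.len1_pos])
      have h' : ((i.1 + 1 : ℕ) : ℝ) ≤ ⌊R.len1 / 2⌋₊ := by exact_mod_cast hi.1
      push_cast at h'; linarith
    have h2 : (i.2 : ℝ) + 1 ≤ R.len2 / 2 := by
      have := Nat.floor_le (show 0 ≤ R.len2 / 2 by linarith [R.len2_pos])
      have h' : ((i.2 + 1 : ℕ) : ℝ) ≤ ⌊R.len2 / 2⌋₊ := by exact_mod_cast hi.2
      push_cast at h'; linarith
    have k1 := abs_lt.1 (key1 i)
    have k2 := abs_lt.1 (key2 i)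
    have n1 : (0 : ℝ) ≤ i.1 := Nat.cast_nonneg _
    have n2 : (0 : ℝ) ≤ i.2 := Nat.cast_nonneg _
    refine mem_latF.2 ((R.mem_iff _).2 ⟨⟨?_, ?_⟩, ?_, ?_⟩) <;> simp only [← hcdef, ← hsdef] <;> linarith
  · intro i _ j _ hij
    have a1 := abs_lt.1 (key1 i)
    have a2 := abs_lt.1 (key2 i)
    have b1 := abs_lt.1 (key1 j)
    have b2 := abs_lt.1 (key2 j)
    rw [hij] at a1 a2
    have l1 : (i.1 : ℝ) < j.1 + 1 := by linarith
    have l2 : (j.1 : ℝ) < i.1 + 1 := by linarith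
    have l3 : (i.2 : ℝ) < j.2 + 1 := by linarith
    have l4 : (j.2 : ℝ) < i.2 + 1 := by linarith
    norm_cast at l1 l2 l3 l4
    ext <;> omega

lemma row_convex {R : Rect} {i k i' j : ℤ} (h : (i, j) ∈ latF R) (h' : (i', j) ∈ latF R)
    (h1 : i ≤ k) (h2 : k ≤ i') : (k, j) ∈ latF R := by
  rw [mem_latF, R.mem_iff] at *
  simp only at *
  have g1 : (i : ℝ) ≤ k := by exact_mod_cast h1
  have g2 : (k : ℝ) ≤ i' := by exact_mod_cast h2
  obtain ⟨⟨a1, a2⟩, a3, a4⟩ := h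
  obtain ⟨⟨b1, b2⟩, b3, b4⟩ := h'
  refine ⟨?_, ?_⟩
  · rcases le_total 0 (Real.cos R.angle) with hc | hc <;> constructor <;>
      nlinarith [mul_nonneg (sub_nonneg.2 g1) (abs_nonneg (Real.cos R.angle))]
  · rcases le_total 0 (Real.sin R.angle) with hc | hc <;> constructor <;>
      nlinarith [mul_nonneg (sub_nonneg.2 g1) (abs_nonneg (Real.sin R.angle))]

lemma row_count {R : Rect} (h0 : ((0 : ℝ), (0 : ℝ)) ∈ R.carrier) (B : Finset (ℤ × ℤ))
    (hB : ∀ q ∈ B, ∃ i, (i, q.2) ∈ latF R) (hinj : Set.InjOn Prod.snd (B : Set (ℤ × ℤ))) :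
    (B.card : ℝ) ≤ 2 * (R.len1 + R.len2) + 1 := by
  have hpos : 0 ≤ R.len1 + R.len2 := by linarith [R.len1_pos, R.len2_pos]
  have hK : 0 ≤ ⌊R.len1 + R.len2⌋ := Int.floor_nonneg.2 hpos
  have := Finset.card_le_card_of_injOn (s := B)
    (t := Finset.Icc (-⌊R.len1 + R.len2⌋) ⌊R.len1 + R.len2⌋) Prod.snd ?_ hinj
  · rw [Int.card_Icc] at this
    have h2 : (B.card : ℤ) ≤ 2 * ⌊R.len1 + R.len2⌋ + 1 := by omega
    have h3 : (B.card : ℝ) ≤ 2 * ⌊R.len1 + R.len2⌋ + 1 := by exact_mod_cast h2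
    linarith [Int.floor_le (R.len1 + R.len2)]
  · intro q hq
    obtain ⟨i, hi⟩ := hB q hq
    obtain ⟨⟨a1, a2⟩, a3, a4⟩ := (R.mem_iff _).1 (mem_latF.1 hi)
    obtain ⟨⟨b1, b2⟩, b3, b4⟩ := (R.mem_iff _).1 h0
    simp only at *
    have := (rot_bound (x := i) (y := q.2) (a := R.len1) (b := R.len2)
      (Real.sin_sq_add_cos_sq R.angle) (abs_le.2 ⟨by nlinarith, by nlinarith⟩)
      (abs_le.2 ⟨by nlinarith, by nlinarith⟩)).2
    rw [abs_le] at this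
    have u : q.2 ≤ ⌊R.len1 + R.len2⌋ := Int.le_floor.2 this.2
    have v : -q.2 ≤ ⌊R.len1 + R.len2⌋ := Int.le_floor.2 (by push_cast; linarith)
    simp only [Finset.coe_Icc, Set.mem_Icc]
    omega

lemma folner_sum {R : Rect} (h0 : ((0 : ℝ), (0 : ℝ)) ∈ R.carrier) (φ : ℤ × ℤ → ℝ) (M : ℝ)
    (hM : ∀ q, |φ q| ≤ M) :
    |∑ q ∈ latF R, (φ q - φ (q.1 + 1, q.2))| ≤ M * (2 * (2 * (R.len1 + R.len2) + 1)) := by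
  classical
  have hM0 : 0 ≤ M := (abs_nonneg _).trans (hM 0)
  let e : ℤ × ℤ ↪ ℤ × ℤ := ⟨fun q => (q.1 + 1, q.2), fun a b h => by
    simp only [Prod.mk.injEq] at h; ext <;> omega⟩
  have he : ∀ a, e a = (a.1 + 1, a.2) := fun _ => rfl
  set F := latF R with hF
  set G := F.map e with hG
  have hGmem : ∀ q, q ∈ G ↔ (q.1 - 1, q.2) ∈ F := by
    intro q
    simp only [hG, Finset.mem_map]
    constructor
    · rintro ⟨a, ha, rfl⟩; simpa [he] using ha
    · intro h; exact ⟨_, h, by simp [he]⟩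
  have h1 : ∑ q ∈ F, (φ q - φ (q.1 + 1, q.2)) = ∑ q ∈ F, φ q - ∑ q ∈ G, φ q := by
    rw [Finset.sum_sub_distrib, hG, Finset.sum_map]; rfl
  have h2 : ∑ q ∈ F, φ q - ∑ q ∈ G, φ q = ∑ q ∈ F \ G, φ q - ∑ q ∈ G \ F, φ q := by
    rw [← Finset.sum_sdiff_sub_sum_sdiff]
  have b : ∀ B : Finset (ℤ × ℤ), |∑ q ∈ B, φ q| ≤ M * B.card := by
    intro B
    refine (Finset.abs_sum_le_sum_abs _ _).trans ?_
    refine (Finset.sum_le_card_nsmul _ _ M fun q _ => hM q).trans ?_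
    rw [nsmul_eq_mul, mul_comm]
  have c1 : ((F \ G).card : ℝ) ≤ 2 * (R.len1 + R.len2) + 1 := by
    refine row_count h0 _ ?_ ?_
    · intro q hq; exact ⟨q.1, (Finset.mem_sdiff.1 hq).1⟩
    · have aux : ∀ a ∈ F \ G, ∀ b ∈ F \ G, a.2 = b.2 → a.1 ≤ b.1 := by
        rintro ⟨a, j⟩ ha ⟨b, j'⟩ hb rfl
        simp only [Finset.mem_sdiff, hGmem] at *
        by_contra hlt
        exact ha.2 (row_convex hb.1 ha.1 (by omega) (by omega))
      intro a ha b hb hab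
      have ha' := Finset.mem_coe.1 ha
      have hb' := Finset.mem_coe.1 hb
      exact Prod.ext (le_antisymm (aux a ha' b hb' hab) (aux b hb' a ha' hab.symm)) hab
  have c2 : ((G \ F).card : ℝ) ≤ 2 * (R.len1 + R.len2) + 1 := by
    refine row_count h0 _ ?_ ?_
    · intro q hq; exact ⟨q.1 - 1, (hGmem _).1 (Finset.mem_sdiff.1 hq).1⟩
    · have aux : ∀ a ∈ G \ F, ∀ b ∈ G \ F, a.2 = b.2 → a.1 ≤ b.1 := by
        rintro ⟨a, j⟩ ha ⟨b, j'⟩ hb rfl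
        simp only [Finset.mem_sdiff, hGmem] at *
        by_contra hlt
        exact hb.2 (row_convex hb.1 ha.1 (by omega) (by omega))
      intro a ha b hb hab
      have ha' := Finset.mem_coe.1 ha
      have hb' := Finset.mem_coe.1 hb
      exact Prod.ext (le_antisymm (aux a ha' b hb' hab) (aux b hb' a ha' hab.symm)) hab
  rw [h1, h2]
  refine (abs_sub _ _).trans ?_
  have := b (F \ G)
  have := b (G \ F)
  nlinarith

lemma folner_avg {R : Rect} (h0 : ((0 : ℝ), (0 : ℝ)) ∈ R.carrier) (φ : ℤ × ℤ → ℝ) (M : ℝ)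
    (hM : ∀ q, |φ q| ≤ M) (hl : 4 ≤ R.shortSide) :
    |((latF R).card : ℝ)⁻¹ * ∑ q ∈ latF R, (φ q - φ (q.1 + 1, q.2))| ≤ 160 * M / R.shortSide := by
  have hM0 : 0 ≤ M := (abs_nonneg _).trans (hM 0)
  have ha : R.shortSide ≤ R.len1 := min_le_left _ _
  have hb : R.shortSide ≤ R.len2 := min_le_right _ _
  have hs := folner_sum h0 φ M hM
  have hc : (⌊R.len1 / 2⌋₊ : ℝ) * ⌊R.len2 / 2⌋₊ ≤ (latF R).card := by exact_mod_cast card_lower R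
  have f1 := (Nat.lt_floor_add_one (R.len1 / 2)).le
  have f2 := (Nat.lt_floor_add_one (R.len2 / 2)).le
  have g : R.len1 / 4 * (R.len2 / 4) ≤ (latF R).card :=
    le_trans (mul_le_mul (by linarith) (by linarith) (by linarith) (by positivity)) hc
  have hpos : 0 < R.len1 / 4 * (R.len2 / 4) := by nlinarith
  have hcpos : (0 : ℝ) < (latF R).card := lt_of_lt_of_le hpos g
  rw [abs_mul, abs_of_nonneg (inv_nonneg.2 hcpos.le), ← div_eq_inv_mul,
    div_le_div_iff₀ hcpos (by linarith)]
  generalize R.shortSide = l at *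
  generalize R.len1 = a at *
  generalize R.len2 = b at *
  have k1 : (2 * (2 * (a + b) + 1)) * l ≤ 160 * (a / 4 * (b / 4)) := by nlinarith
  calc _ ≤ (M * (2 * (2 * (a + b) + 1))) * l := mul_le_mul_of_nonneg_right hs (by linarith)
    _ = M * ((2 * (2 * (a + b) + 1)) * l) := by ring
    _ ≤ M * (160 * (a / 4 * (b / 4))) := mul_le_mul_of_nonneg_left k1 hM0
    _ ≤ M * (160 * (latF R).card) := by gcongr
    _ = _ := by ring

lemma ergAvg_eq (S T : X ≃ᵐ X) (R : Rect) (f : X → ℝ) (x : X) :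
    ergAvg S T R f x = ((latF R).card : ℝ)⁻¹ *
      ∑ q ∈ latF R, f ((S.toEquiv ^ q.1) ((T.toEquiv ^ q.2) x)) := by
  unfold ergAvg
  rw [latticeCount_eq, finsum_mem_eq_finite_toFinset_sum _ R.finite_lattice]
  rfl

lemma mp_zpow {μ : Measure X} (S : X ≃ᵐ X) (h : MeasurePreserving S μ μ) (i : ℤ) :
    MeasurePreserving (⇑(S.toEquiv ^ i)) μ μ := by
  have hn : ∀ (U : X ≃ᵐ X), MeasurePreserving U μ μ → ∀ n : ℕ,
      MeasurePreserving (⇑(U.toEquiv ^ n)) μ μ := by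
    intro U hU n
    rw [Equiv.Perm.coe_pow]
    exact hU.iterate n
  cases i with
  | ofNat n => simpa using hn S h n
  | negSucc n =>
    rw [zpow_negSucc, ← inv_pow]
    exact hn S.symm (h.symm S) (n + 1)

lemma mp_act {μ : Measure X} {S T : X ≃ᵐ X} (h : ErgodicSetup μ S T) (q : ℤ × ℤ) :
    MeasurePreserving (fun x => (S.toEquiv ^ q.1) ((T.toEquiv ^ q.2) x)) μ μ :=
  (mp_zpow S h.measPres_S q.1).comp (mp_zpow T h.measPres_T q.2)

lemma ergAvg_mono_ae {μ : Measure X} {S T : X ≃ᵐ X} (h : ErgodicSetup μ S T) {f g : X → ℝ}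
    (hfg : ∀ᵐ x ∂μ, f x ≤ g x) (R : ℕ → Rect) :
    ∀ᵐ x ∂μ, ∀ n, ergAvg S T (R n) f x ≤ ergAvg S T (R n) g x := by
  have : ∀ᵐ x ∂μ, ∀ q : ℤ × ℤ, f ((S.toEquiv ^ q.1) ((T.toEquiv ^ q.2) x)) ≤
      g ((S.toEquiv ^ q.1) ((T.toEquiv ^ q.2) x)) := by
    rw [ae_all_iff]
    intro q
    exact (mp_act h q).quasiMeasurePreserving.ae hfg
  filter_upwards [this] with x hx n
  rw [ergAvg_eq, ergAvg_eq]
  gcongr with q _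
  exact hx q

lemma ergAvg_const_mul (S T : X ≃ᵐ X) (R : Rect) (c : ℝ) (f : X → ℝ) (x : X) :
    ergAvg S T R (fun y => c * f y) x = c * ergAvg S T R f x := by
  rw [ergAvg_eq, ergAvg_eq, ← Finset.mul_sum]; ring

lemma ergAvg_add (S T : X ≃ᵐ X) (R : Rect) (f g : X → ℝ) (x : X) :
    ergAvg S T R (fun y => f y + g y) x = ergAvg S T R f x + ergAvg S T R g x := by
  rw [ergAvg_eq, ergAvg_eq, ergAvg_eq, Finset.sum_add_distrib]; ring

lemma abs_ergAvg_le (S T : X ≃ᵐ X) (R : Rect) (f : X → ℝ) (x : X) :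
    |ergAvg S T R f x| ≤ ergAvg S T R (fun y => |f y|) x := by
  rw [ergAvg_eq, ergAvg_eq, abs_mul, abs_of_nonneg (by positivity)]
  gcongr
  exact Finset.abs_sum_le_sum_abs _ _

lemma ergAvg_const (S T : X ≃ᵐ X) {R : Rect} (h0 : ((0 : ℝ), (0 : ℝ)) ∈ R.carrier) (c : ℝ) (x : X) :
    ergAvg S T R (fun _ => c) x = c := by
  have : (latF R).card ≠ 0 := Finset.card_ne_zero_of_mem (a := (0, 0)) (mem_latF.2 (by simpa using h0))
  rw [ergAvg_eq, Finset.sum_const, nsmul_eq_mul]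
  field_simp

lemma ergAvg_comp {S T : X ≃ᵐ X} (hc : ∀ x, S (T x) = T (S x)) (R : Rect) (f : X → ℝ) (k : ℕ)
    (x : X) : ergAvg S T R (fun y => f (S^[k] y)) x = ergAvg S T R f (S^[k] x) := by
  rw [ergAvg_eq, ergAvg_eq]
  congr 1
  refine Finset.sum_congr rfl fun q _ => ?_
  congr 1
  have hcomm : Commute S.toEquiv T.toEquiv := Equiv.ext hc
  have e : ∀ y, S^[k] y = (S.toEquiv ^ k) y := fun y => by rw [Equiv.Perm.coe_pow]; rfl
  rw [e, e, ← Equiv.Perm.mul_apply, ← Equiv.Perm.mul_apply, ← Equiv.Perm.mul_apply,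
    ← Equiv.Perm.mul_apply]
  congr 1
  have c1 : Commute (S.toEquiv ^ k) (S.toEquiv ^ q.1) := ((Commute.refl _).pow_left k).zpow_right _
  have c2 : Commute (S.toEquiv ^ k) (T.toEquiv ^ q.2) := (hcomm.pow_left k).zpow_right _
  rw [c1.eq, mul_assoc, c2.eq, mul_assoc]

lemma ergAvg_cob {S T : X ≃ᵐ X} {R : Rect}
    (h0 : ((0 : ℝ), (0 : ℝ)) ∈ R.carrier) (h : X → ℝ) (M : ℝ) (hM : ∀ x, |h x| ≤ M)
    (hl : 4 ≤ R.shortSide) (x : X) :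
    |ergAvg S T R (fun y => h y - h (S y)) x| ≤ 160 * M / R.shortSide := by
  rw [ergAvg_eq]
  have := folner_avg h0 (fun q => h ((S.toEquiv ^ q.1) ((T.toEquiv ^ q.2) x))) M (fun q => hM _) hl
  convert this using 7
  rw [add_comm, zpow_one_add]
  rfl

lemma ergAvg_meas (S T : X ≃ᵐ X) (R : Rect) {f : X → ℝ} (hf : Measurable f) :
    Measurable (ergAvg S T R f) := by
  have hz : ∀ (U : X ≃ᵐ X) (i : ℤ), Measurable (⇑(U.toEquiv ^ i)) := by
    have hn : ∀ (U : X ≃ᵐ X) (n : ℕ), Measurable (⇑(U.toEquiv ^ n)) := by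
      intro U n
      rw [Equiv.Perm.coe_pow]
      exact U.measurable.iterate n
    intro U i
    cases i with
    | ofNat n => simpa using hn U n
    | negSucc n =>
      rw [zpow_negSucc, ← inv_pow]
      exact hn U.symm (n + 1)
  rw [show ergAvg S T R f = _ from funext (ergAvg_eq S T R f)]
  exact (Finset.measurable_sum _ fun q _ => hf.comp ((hz S q.1).comp (hz T q.2))).const_mul _

lemma maxOp_meas (S T : X ≃ᵐ X) (R : ℕ → Rect) {f : X → ℝ} (hf : Measurable f) :
    Measurable (maxOp S T R f) :=
  Measurable.iSup fun n => (ergAvg_meas S T (R n) hf.abs).ennreal_ofReal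

lemma maxOp_mono_ae {μ : Measure X} {S T : X ≃ᵐ X} (h : ErgodicSetup μ S T) {f g : X → ℝ}
    (hfg : ∀ᵐ x ∂μ, |f x| ≤ |g x|) (R : ℕ → Rect) :
    ∀ᵐ x ∂μ, maxOp S T R f x ≤ maxOp S T R g x := by
  filter_upwards [ergAvg_mono_ae h hfg R] with x hx
  exact iSup_mono fun n => ENNReal.ofReal_le_ofReal (hx n)

lemma maxOp_const_mul (S T : X ≃ᵐ X) (R : ℕ → Rect) {c : ℝ} (hc : 0 ≤ c) (f : X → ℝ) (x : X) :
    maxOp S T R (fun y => c * f y) x = ENNReal.ofReal c * maxOp S T R f x := by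
  unfold maxOp
  rw [ENNReal.mul_iSup]
  refine iSup_congr fun n => ?_
  simp only [abs_mul, abs_of_nonneg hc]
  rw [ergAvg_const_mul, ENNReal.ofReal_mul hc]

lemma maxOp_comp {S T : X ≃ᵐ X} (hc : ∀ x, S (T x) = T (S x)) (R : ℕ → Rect) (f : X → ℝ) (k : ℕ)
    (x : X) : maxOp S T R (fun y => f (S^[k] y)) x = maxOp S T R f (S^[k] x) := by
  unfold maxOp
  exact iSup_congr fun n => by rw [ergAvg_comp hc (R n) (fun y => |f y|) k x]

lemma maxOp_lt_top {S T : X ≃ᵐ X} (R : ℕ → Rect) {f : X → ℝ} (hf : ∀ x, 0 ≤ f x) {x : X} {L : ℝ}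
    (h : Tendsto (fun n => ergAvg S T (R n) f x) atTop (𝓝 L)) : maxOp S T R f x < ⊤ := by
  obtain ⟨C, hC⟩ := h.bddAbove_range
  refine lt_of_le_of_lt (iSup_le fun n => ENNReal.ofReal_le_ofReal ?_) (ENNReal.ofReal_lt_top (r := C))
  simp only [abs_of_nonneg (hf _)]
  exact hC ⟨n, rfl⟩

lemma memLp_bdd {μ : Measure X} [IsProbabilityMeasure μ] {f : X → ℝ} (hf : Measurable f) {M : ℝ}
    (hM : ∀ x, |f x| ≤ M) (p : ℝ≥0∞) : MemLp f p μ :=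
  MemLp.of_bound hf.aestronglyMeasurable M (Eventually.of_forall hM)

lemma birk_meas {S : X → X} (hS : Measurable S) {f : X → ℝ} (hf : Measurable f) (N : ℕ) :
    Measurable (birkhoffAverage ℝ S f N) := by
  change Measurable fun x => (N : ℝ)⁻¹ * ∑ k ∈ Finset.range N, f (S^[k] x)
  exact (Finset.measurable_sum _ fun k _ => hf.comp (hS.iterate k)).const_mul _

lemma birk_bdd {S : X → X} {f : X → ℝ} {M : ℝ} (hM : ∀ x, |f x| ≤ M) (N : ℕ) (x : X) :
    |birkhoffAverage ℝ S f N x| ≤ M := by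
  have hM0 : 0 ≤ M := (abs_nonneg _).trans (hM x)
  unfold birkhoffAverage birkhoffSum
  rw [smul_eq_mul, abs_mul, abs_of_nonneg (by positivity)]
  have : |∑ k ∈ Finset.range N, f (S^[k] x)| ≤ N * M := by
    refine (Finset.abs_sum_le_sum_abs _ _).trans ?_
    refine (Finset.sum_le_card_nsmul _ _ M fun q _ => hM _).trans ?_
    simp
  rcases Nat.eq_zero_or_pos N with rfl | hN
  · simpa using hM0
  · have : (0 : ℝ) < N := by exact_mod_cast hN
    rw [inv_mul_le_iff₀ this]; assumption

lemma meanErg_const {μ : Measure X} [IsProbabilityMeasure μ] {S : X → X} (hS : Ergodic S μ)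
    {f : X → ℝ} (hf : Measurable f) {M : ℝ} (hM : ∀ x, |f x| ≤ M) :
    ∃ c : ℝ, Tendsto (fun N => ∫ x, |birkhoffAverage ℝ S f N x - c| ∂μ) atTop (𝓝 0) := by
  have hmp : MeasurePreserving S μ μ := hS.1
  let U : Lp ℝ 2 μ →L[ℝ] Lp ℝ 2 μ :=
    (Lp.compMeasurePreservingₗᵢ ℝ S hmp).toContinuousLinearMap
  have hU : ‖U‖ ≤ 1 := LinearIsometry.norm_toContinuousLinearMap_le _
  have hfL := memLp_bdd (μ := μ) hf hM 2
  have key := U.tendsto_birkhoffAverage_orthogonalProjection hU (hfL.toLp f)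
  generalize hP : (U.eqLocus (1 : Lp ℝ 2 μ →L[ℝ] Lp ℝ 2 μ)).orthogonalProjectionOnto (hfL.toLp f) = P at key
  have hfix : U P.1 = P.1 := P.2
  have hfix' : (P.1 : X → ℝ) ∘ S =ᵐ[μ] P.1 := by
    have h1 : Lp.compMeasurePreserving S hmp P.1 = P.1 := hfix
    have h2 := Lp.coeFn_compMeasurePreserving P.1 hmp
    rw [h1] at h2
    exact h2.symm
  obtain ⟨c, hc⟩ := hS.ae_eq_const_of_ae_eq_comp_ae (Lp.aestronglyMeasurable P.1) hfix'
  have hUf : ∀ k, ((U^[k] (hfL.toLp f) : Lp ℝ 2 μ) : X → ℝ) =ᵐ[μ] fun x => f (S^[k] x) := by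
    intro k
    have : U^[k] (hfL.toLp f) = Lp.compMeasurePreserving S^[k] (hmp.iterate k) (hfL.toLp f) := by
      rw [← Lp.compMeasurePreserving_iterate]; rfl
    rw [this, Lp.toLp_compMeasurePreserving]
    exact MemLp.coeFn_toLp _
  have hb : ∀ N, ((birkhoffAverage ℝ U _root_.id N (hfL.toLp f) : Lp ℝ 2 μ) : X → ℝ) =ᵐ[μ]
      birkhoffAverage ℝ S f N := by
    intro N
    have hsum : ∀ N, ((birkhoffSum U _root_.id N (hfL.toLp f) : Lp ℝ 2 μ) : X → ℝ) =ᵐ[μ] birkhoffSum S f N := by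
      intro N
      induction N with
      | zero =>
        simp only [birkhoffSum_zero']
        filter_upwards [Lp.coeFn_zero ℝ 2 μ] with x hx
        simpa using hx
      | succ N ih =>
        rw [birkhoffSum_succ]
        filter_upwards [Lp.coeFn_add (birkhoffSum U _root_.id N (hfL.toLp f)) (U^[N] (hfL.toLp f)),
          ih, hUf N] with x h1 h2 h3
        rw [birkhoffSum_succ]
        refine h1.trans ?_
        rw [Pi.add_apply, h2, h3]
    unfold birkhoffAverage
    filter_upwards [Lp.coeFn_smul (N : ℝ)⁻¹ (birkhoffSum U _root_.id N (hfL.toLp f)), hsum N] with x h1 h2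
    rw [h1, Pi.smul_apply, h2]
  refine ⟨c, ?_⟩
  rw [tendsto_iff_norm_sub_tendsto_zero] at key
  refine squeeze_zero (fun N => integral_nonneg fun x => abs_nonneg _) (fun N => ?_) key
  have hmeas : AEStronglyMeasurable (fun x => birkhoffAverage ℝ S f N x - c) μ :=
    ((birk_meas hmp.measurable hf N).sub_const c).aestronglyMeasurable
  have e1 : eLpNorm (fun x => birkhoffAverage ℝ S f N x - c) 1 μ ≤
      eLpNorm (fun x => birkhoffAverage ℝ S f N x - c) 2 μ :=
    eLpNorm_le_eLpNorm_of_exponent_le (by norm_num) hmeas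
  have e2 : eLpNorm (fun x => birkhoffAverage ℝ S f N x - c) 2 μ =
      eLpNorm (birkhoffAverage ℝ U _root_.id N (hfL.toLp f) - P.1 : Lp ℝ 2 μ) 2 μ := by
    refine eLpNorm_congr_ae ?_
    filter_upwards [hb N, hc, Lp.coeFn_sub (birkhoffAverage ℝ U _root_.id N (hfL.toLp f)) P.1]
      with x h1 h2 h3
    rw [h3, Pi.sub_apply, h1, h2, Function.const_apply]
  rw [Lp.norm_def, ← e2]
  have e3 : ∫ x, |birkhoffAverage ℝ S f N x - c| ∂μ =
      (eLpNorm (fun x => birkhoffAverage ℝ S f N x - c) 1 μ).toReal := by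
    rw [eLpNorm_one_eq_lintegral_enorm, ← integral_norm_eq_lintegral_enorm hmeas]; rfl
  rw [e3]
  refine ENNReal.toReal_mono ?_ e1
  rw [e2]
  exact Lp.eLpNorm_ne_top _

lemma birk_int {μ : Measure X} [IsProbabilityMeasure μ] {S : X → X} (hS : MeasurePreserving S μ μ)
    {f : X → ℝ} (hf : Measurable f) {M : ℝ} (hM : ∀ x, |f x| ≤ M) {N : ℕ} (hN : 0 < N) :
    ∫ x, birkhoffAverage ℝ S f N x ∂μ = ∫ x, f x ∂μ := by
  unfold birkhoffAverage birkhoffSum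
  rw [integral_smul, integral_finsetSum]
  · have : ∀ k, ∫ x, f (S^[k] x) ∂μ = ∫ x, f x ∂μ := fun k => by
      have hk := hS.iterate k
      have h1 := integral_map (μ := μ) (f := f) hk.measurable.aemeasurable hf.aestronglyMeasurable
      rw [hk.map_eq] at h1
      exact h1.symm
    simp only [this]
    have : (N : ℝ) ≠ 0 := by positivity
    simp [this]
  · intro k _
    exact memLp_one_iff_integrable.1
      (memLp_bdd (hf.comp (hS.measurable.iterate k)) (M := M) (fun x => hM _) 1)

lemma meanErg {μ : Measure X} [IsProbabilityMeasure μ] {S : X → X} (hS : Ergodic S μ)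
    {f : X → ℝ} (hf : Measurable f) {M : ℝ} (hM : ∀ x, |f x| ≤ M) :
    Tendsto (fun N => ∫ x, |birkhoffAverage ℝ S f N x - ∫ y, f y ∂μ| ∂μ) atTop (𝓝 0) := by
  obtain ⟨c, hc⟩ := meanErg_const hS hf hM
  have : |∫ y, f y ∂μ - c| ≤ 0 := by
    refine ge_of_tendsto hc ?_
    filter_upwards [eventually_gt_atTop 0] with N hN
    rw [← birk_int hS.1 hf hM hN]
    have hi : Integrable (birkhoffAverage ℝ S f N) μ := memLp_one_iff_integrable.1
      (memLp_bdd (birk_meas hS.1.measurable hf N) (birk_bdd hM N) 1)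
    have : ∫ x, birkhoffAverage ℝ S f N x ∂μ - c = ∫ x, (birkhoffAverage ℝ S f N x - c) ∂μ := by
      rw [integral_sub hi (integrable_const c)]; simp
    rw [this]
    exact abs_integral_le_integral_abs
  have h0 : ∫ y, f y ∂μ = c := by
    have := abs_eq_zero.1 (le_antisymm this (abs_nonneg _)); linarith
  rw [h0]; exact hc

lemma mixing {μ : Measure X} [IsProbabilityMeasure μ] {S : X → X} (hS : Ergodic S μ)
    {A E : Set X} (hA : MeasurableSet A) (hE : MeasurableSet E) :
    ∃ n : ℕ, μ.real A * μ.real E / 2 ≤ μ.real (A ∩ S^[n] ⁻¹' E) := by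
  by_contra! hcon
  have hpos : 0 < μ.real A * μ.real E := by
    have := hcon 0
    have := measureReal_nonneg (μ := μ) (s := A ∩ S^[0] ⁻¹' E)
    linarith
  let f : X → ℝ := E.indicator fun _ => 1
  have hf : Measurable f := measurable_const.indicator hE
  have hM : ∀ x, |f x| ≤ 1 := fun x => by
    by_cases h : x ∈ E <;> simp [f, h]
  have hint : ∫ x, f x ∂μ = μ.real E := by simp [f, integral_indicator_const, hE]
  have ht := meanErg hS hf hM
  obtain ⟨N, hN, hN0⟩ := ((ht.eventually (gt_mem_nhds (half_pos hpos))).and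
    (eventually_gt_atTop 0)).exists
  rw [hint] at hN
  have hi : Integrable (birkhoffAverage ℝ S f N) μ := memLp_one_iff_integrable.1
      (memLp_bdd (birk_meas hS.1.measurable hf N) (birk_bdd hM N) 1)
  have h1 : ∫ x in A, birkhoffAverage ℝ S f N x ∂μ ≤ μ.real A * μ.real E / 2 := by
    have e : ∫ x in A, birkhoffAverage ℝ S f N x ∂μ =
        (N : ℝ)⁻¹ * ∑ k ∈ Finset.range N, μ.real (A ∩ S^[k] ⁻¹' E) := by
      unfold birkhoffAverage birkhoffSum
      rw [integral_smul, integral_finsetSum, smul_eq_mul]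
      · congr 1
        refine Finset.sum_congr rfl fun k _ => ?_
        have : (fun x => f (S^[k] x)) = (S^[k] ⁻¹' E).indicator fun _ => 1 := by
          ext x; rfl
        rw [this, setIntegral_indicator ((hS.1.measurable.iterate k) hE)]
        simp
      · intro k _
        exact (memLp_one_iff_integrable.1
          (memLp_bdd (hf.comp (hS.1.measurable.iterate k)) (M := 1) (fun x => hM _) 1)).integrableOn
    rw [e, inv_mul_le_iff₀ (by positivity)]
    refine (Finset.sum_le_card_nsmul _ _ _ fun k _ => (hcon k).le).trans ?_
    simp
  have h2 : μ.real A * μ.real E - ∫ x in A, birkhoffAverage ℝ S f N x ∂μ ≤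
      ∫ x, |birkhoffAverage ℝ S f N x - μ.real E| ∂μ := by
    have hi' : Integrable (fun x => birkhoffAverage ℝ S f N x - μ.real E) μ :=
      hi.sub (integrable_const _)
    have e : ∫ x in A, (birkhoffAverage ℝ S f N x - μ.real E) ∂μ =
        ∫ x in A, birkhoffAverage ℝ S f N x ∂μ - μ.real A * μ.real E := by
      rw [integral_sub hi.integrableOn (integrable_const _)]; simp
    have l1 : |∫ x in A, (birkhoffAverage ℝ S f N x - μ.real E) ∂μ| ≤
      ∫ x in A, |birkhoffAverage ℝ S f N x - μ.real E| ∂μ := abs_integral_le_integral_abs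
    have l2 : ∫ x in A, |birkhoffAverage ℝ S f N x - μ.real E| ∂μ ≤
        ∫ x, |birkhoffAverage ℝ S f N x - μ.real E| ∂μ :=
      setIntegral_le_integral hi'.abs (Eventually.of_forall fun x => abs_nonneg _)
    rw [e] at l1
    have := (abs_le.1 l1).1
    linarith
  linarith

lemma covering {μ : Measure X} [IsProbabilityMeasure μ] {S : X → X} (hS : Ergodic S μ)
    {E : Set X} (hE : MeasurableSet E) (m : ℕ) (hm : 2 ≤ m * μ.real E) :
    ∃ n : ℕ → ℕ, 1 / 2 ≤ μ.real (⋃ i ∈ Finset.range m, S^[n i] ⁻¹' E) := by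
  choose φ hφ using fun A : {A : Set X // MeasurableSet A} => mixing hS A.2 hE
  let U : ℕ → {A : Set X // MeasurableSet A} := fun k => Nat.rec ⟨∅, MeasurableSet.empty⟩
    (fun _ V => ⟨V.1 ∪ S^[φ ⟨V.1ᶜ, V.2.compl⟩] ⁻¹' E, V.2.union ((hS.1.measurable.iterate _) hE)⟩) k
  let n : ℕ → ℕ := fun i => φ ⟨(U i).1ᶜ, (U i).2.compl⟩
  have hU : ∀ i, (U (i + 1)).1 = (U i).1 ∪ S^[n i] ⁻¹' E := fun i => rfl
  have hUn : ∀ m, (U m).1 = ⋃ i ∈ Finset.range m, S^[n i] ⁻¹' E := by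
    intro m
    induction m with
    | zero => simp [U]
    | succ m ih => rw [hU, ih, Finset.range_add_one, Finset.set_biUnion_insert, union_comm]
  refine ⟨n, ?_⟩
  rw [← hUn]
  by_contra! hlt
  have hmono : ∀ i j, i ≤ j → μ.real (U i).1 ≤ μ.real (U j).1 := by
    intro i j hij
    refine measureReal_mono ?_
    rw [hUn, hUn]
    refine biUnion_subset_biUnion_left ?_
    intro a ha; simp at *; omega
  have step : ∀ k ≤ m, k * (μ.real E / 4) ≤ μ.real (U k).1 := by
    intro k hk
    induction k with
    | zero => simp [measureReal_nonneg]
    | succ k ih =>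
      have ih := ih (by omega)
      have h1 := hφ ⟨(U k).1ᶜ, (U k).2.compl⟩
      simp only at h1
      have h2 : μ.real (U k).1ᶜ = 1 - μ.real (U k).1 := probReal_compl_eq_one_sub (U k).2
      have h3 : μ.real (U (k+1)).1 = μ.real (U k).1 + μ.real ((U k).1ᶜ ∩ S^[n k] ⁻¹' E) := by
        rw [hU, ← measureReal_union (disjoint_compl_right.mono_right inter_subset_left)
          ((U k).2.compl.inter ((hS.1.measurable.iterate _) hE))]
        congr 1
        ext x; simp; tauto
      have h4 := hmono k m (by omega)
      have h5 : μ.real (U k).1ᶜ * μ.real E / 2 ≤ μ.real ((U k).1ᶜ ∩ S^[n k] ⁻¹' E) := h1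
      have h6 := measureReal_nonneg (μ := μ) (s := E)
      push_cast
      nlinarith
  have := step m le_rfl
  linarith

lemma eLpNorm_pow {μ : Measure X} {p : ℝ} (hp : 1 ≤ p) (f : X → ℝ) :
    eLpNorm f (ENNReal.ofReal p) μ ^ p = ∫⁻ x, ENNReal.ofReal (|f x| ^ p) ∂μ := by
  have hp0 : 0 < p := by linarith
  rw [eLpNorm_eq_lintegral_rpow_enorm_toReal (by simpa using hp0) ENNReal.ofReal_ne_top,
    ENNReal.toReal_ofReal hp0.le, ← ENNReal.rpow_mul, one_div_mul_cancel hp0.ne', ENNReal.rpow_one]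
  refine lintegral_congr fun x => ?_
  rw [← ENNReal.ofReal_rpow_of_nonneg (abs_nonneg _) hp0.le, Real.enorm_eq_ofReal_abs]

lemma cob_exists {S : X → X} (hS : Measurable S) {f : X → ℝ} (hf : Measurable f) {M : ℝ}
    (hM : ∀ x, |f x| ≤ M) {N : ℕ} (hN : 0 < N) :
    ∃ h : X → ℝ, (Measurable h) ∧ (∀ x, |h x| ≤ N * M) ∧
      ∀ x, h x - h (S x) = f x - birkhoffAverage ℝ S f N x := by
  have hN' : (0 : ℝ) < N := by exact_mod_cast hN
  have hbs : ∀ k, Measurable (birkhoffSum S f k) := fun k =>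
    Finset.measurable_sum _ fun k _ => hf.comp (hS.iterate k)
  refine ⟨fun x => (N : ℝ)⁻¹ * ∑ k ∈ Finset.range N, birkhoffSum S f k x, ?_, ?_, ?_⟩
  · exact (Finset.measurable_sum _ fun k _ => hbs k).const_mul _
  · intro x
    have hM0 : 0 ≤ M := (abs_nonneg _).trans (hM x)
    rw [abs_mul, abs_of_nonneg (by positivity), inv_mul_le_iff₀ hN']
    refine (Finset.abs_sum_le_sum_abs _ _).trans ?_
    refine (Finset.sum_le_card_nsmul _ _ (N * M) fun k hk => ?_).trans (by simp)
    unfold birkhoffSum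
    refine (Finset.abs_sum_le_sum_abs _ _).trans ?_
    refine (Finset.sum_le_card_nsmul _ _ M fun q _ => hM _).trans ?_
    have : (k : ℝ) ≤ N := by exact_mod_cast (Finset.mem_range.1 hk).le
    simp only [Finset.card_range, nsmul_eq_mul]
    gcongr
  · intro x
    have : ∀ k, birkhoffSum S f k x - birkhoffSum S f k (S x) = f x - f (S^[k] x) := fun k => by
      have := birkhoffSum_apply_sub_birkhoffSum S f k x; linarith
    rw [← mul_sub, ← Finset.sum_sub_distrib]
    simp only [this]
    rw [Finset.sum_sub_distrib, mul_sub]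
    simp only [Finset.sum_const, Finset.card_range, nsmul_eq_mul, birkhoffAverage, birkhoffSum,
      smul_eq_mul]
    field_simp

lemma approx {μ : Measure X} [IsProbabilityMeasure μ] {S : X → X} (hS : Ergodic S μ)
    {p : ℝ} (hp : 1 ≤ p) {f : X → ℝ} (hf : MemLp f (ENNReal.ofReal p) μ) {δ : ℝ} (hδ : 0 < δ) :
    ∃ (c : ℝ) (h : X → ℝ) (M : ℝ), Measurable h ∧ (∀ x, |h x| ≤ M) ∧
      eLpNorm (fun x => f x - c - (h x - h (S x))) (ENNReal.ofReal p) μ ≤ ENNReal.ofReal δ := by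
  have hp0 : 0 < p := by linarith
  obtain ⟨g, hg, -⟩ := hf.exists_simpleFunc_eLpNorm_sub_lt ENNReal.ofReal_ne_top
    (ε := ENNReal.ofReal (δ / 2)) (by simpa using hδ)
  obtain ⟨M, hM⟩ := g.exists_forall_norm_le
  simp only [Real.norm_eq_abs] at hM
  have hgm : Measurable g := g.measurable
  set c := ∫ x, g x ∂μ
  have ht := meanErg hS hgm hM
  let K : ℝ := |M| + |c| + 1
  have hK : 0 < K := by positivity
  have ht2 := ht.const_mul (K ^ (p - 1))
  rw [mul_zero] at ht2
  have hδp : 0 < (δ / 2) ^ p := by positivity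
  obtain ⟨N, hN, hN0⟩ := ((ht2.eventually (gt_mem_nhds hδp)).and (eventually_gt_atTop 0)).exists
  obtain ⟨h, hhm, hhb, hh⟩ := cob_exists hS.1.measurable hgm hM hN0
  refine ⟨c, h, N * M, hhm, hhb, ?_⟩
  have e : (fun x => f x - c - (h x - h (S x))) =
      (f - ⇑g) + fun x => (birkhoffAverage ℝ S g N x - c) := by
    ext x; simp only [hh, Pi.add_apply, Pi.sub_apply]; ring
  have hbm : Measurable fun x => (birkhoffAverage ℝ S g N x - c) :=
    (birk_meas hS.1.measurable hgm N).sub_const c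
  have hdK : ∀ x, |birkhoffAverage ℝ S g N x - c| ≤ K := fun x => by
    have h1 := birk_bdd (S := S) hM N x
    have h2 := abs_sub (birkhoffAverage ℝ S g N x) c
    have h3 := le_abs_self M
    simp only [K]; linarith
  have b2 : eLpNorm (fun x => (birkhoffAverage ℝ S g N x - c)) (ENNReal.ofReal p) μ ≤
      ENNReal.ofReal (δ / 2) := by
    rw [← ENNReal.rpow_le_rpow_iff hp0, eLpNorm_pow hp,
      ENNReal.ofReal_rpow_of_nonneg (by positivity) hp0.le]
    have hi : Integrable (fun x => |birkhoffAverage ℝ S g N x - c|) μ :=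
      (memLp_one_iff_integrable.1 (memLp_bdd hbm hdK 1)).abs
    calc _ ≤ ∫⁻ x, ENNReal.ofReal (K ^ (p - 1) * |birkhoffAverage ℝ S g N x - c|) ∂μ := by
          refine lintegral_mono fun x => ENNReal.ofReal_le_ofReal ?_
          rcases (abs_nonneg (birkhoffAverage ℝ S g N x - c)).eq_or_lt with h0 | h0
          · rw [← h0, Real.zero_rpow hp0.ne', mul_zero]
          · have : |birkhoffAverage ℝ S g N x - c| ^ p =
              |birkhoffAverage ℝ S g N x - c| ^ (p - 1) * |birkhoffAverage ℝ S g N x - c| := by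
              rw [← Real.rpow_add_one h0.ne']; simp
            rw [this]
            exact mul_le_mul_of_nonneg_right (Real.rpow_le_rpow h0.le (hdK x) (by linarith)) h0.le
      _ = ENNReal.ofReal (K ^ (p - 1) * ∫ x, |birkhoffAverage ℝ S g N x - c| ∂μ) := by
          rw [← integral_const_mul, ofReal_integral_eq_lintegral_ofReal (hi.const_mul _)]
          exact Eventually.of_forall fun x => by positivity
      _ ≤ _ := ENNReal.ofReal_le_ofReal hN.le
  rw [e]
  refine (eLpNorm_add_le (hf.1.sub hgm.aestronglyMeasurable) hbm.aestronglyMeasurable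
    (by simpa using hp)).trans ?_
  refine (add_le_add hg.le b2).trans ?_
  rw [← ENNReal.ofReal_add (by positivity) (by positivity)]
  simp

lemma weak_imp_conv {μ : Measure X} {S T : X ≃ᵐ X}
    (hsetup : ErgodicSetup μ S T) {R : ℕ → Rect} (hR : IsProcess R)
    {p : ℝ} (hp : 1 ≤ p) (hw : IsWeakType μ (maxOp S T R) p) {f : X → ℝ}
    (hf : MemLp f (ENNReal.ofReal p) μ) : AEConverges μ S T R f := by
  have := hsetup.prob
  have hp0 : 0 < p := by linarith
  obtain ⟨C, hC, hw⟩ := hw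
  have main : ∀ ε : ℝ, 0 < ε → ∀ᵐ x ∂μ, ∃ N, ∀ n ≥ N, ∀ m ≥ N,
      |ergAvg S T (R n) f x - ergAvg S T (R m) f x| ≤ ε := by
    intro ε hε
    rw [ae_iff, ← nonpos_iff_eq_zero]
    refine ENNReal.le_of_forall_pos_le_add fun η hη _ => ?_
    rw [zero_add]
    have hη' : (0 : ℝ) < η := hη
    let t : ℝ := min 1 (η / C)
    have ht0 : 0 < t := lt_min one_pos (by positivity)
    obtain ⟨c, h, M, hhm, hhb, hr⟩ := approx hsetup.erg_S hp hf (δ := ε / 4 * t) (by positivity)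
    set r : X → ℝ := fun x => f x - c - (h x - h (S x)) with hrdef
    have hSm : Measurable S := S.measurable
    have hrL : MemLp r (ENNReal.ofReal p) μ :=
      ⟨(hf.1.sub aestronglyMeasurable_const).sub
        (hhm.sub (hhm.comp hSm)).aestronglyMeasurable, hr.trans_lt ENNReal.ofReal_lt_top⟩
    have hwr := hw r hrL (ε / 4) (by positivity)
    refine le_trans (measure_mono ?_) (hwr.trans ?_)
    · intro x hx
      simp only [mem_setOf_eq] at hx ⊢
      by_contra hle
      rw [not_lt] at hle
      apply hx
      have hrb : ∀ n, |ergAvg S T (R n) r x| ≤ ε / 4 := by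
        intro n
        refine (abs_ergAvg_le _ _ _ _ _).trans ?_
        exact (ENNReal.ofReal_le_ofReal_iff (by positivity)).1
          ((le_iSup (fun n => ENNReal.ofReal (ergAvg S T (R n) (fun y => |r y|) x)) n).trans hle)
      have hdec : ∀ n, ergAvg S T (R n) f x = ergAvg S T (R n) r x + c +
          ergAvg S T (R n) (fun y => h y - h (S y)) x := by
        intro n
        have e : f = fun y => (fun y => r y + (fun _ => c) y) y + (fun y => h y - h (S y)) y := by
          ext y; simp only [hrdef]; ring
        conv_lhs => rw [e]
        rw [ergAvg_add, ergAvg_add, ergAvg_const S T (hR.1 n)]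
      have hev : ∀ᶠ n in atTop, |ergAvg S T (R n) (fun y => h y - h (S y)) x| ≤ ε / 4 := by
        filter_upwards [hR.2.eventually_ge_atTop 4,
          hR.2.eventually_ge_atTop (160 * M / (ε / 4))] with n h4 h5
        refine (ergAvg_cob (hR.1 n) h M hhb h4 x).trans ?_
        rw [div_le_iff₀ (by positivity)] at h5
        rw [div_le_iff₀ (by linarith)]
        linarith
      obtain ⟨N, hN⟩ := eventually_atTop.1 hev
      refine ⟨N, fun n hn m hm => ?_⟩
      rw [hdec n, hdec m]
      have a1 := abs_le.1 (hrb n)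
      have a2 := abs_le.1 (hrb m)
      have a3 := abs_le.1 (hN n hn)
      have a4 := abs_le.1 (hN m hm)
      rw [abs_le]; constructor <;> linarith
    · rw [← ENNReal.ofReal_coe_nnreal]
      refine ENNReal.ofReal_le_ofReal ?_
      have k1 : (eLpNorm r (ENNReal.ofReal p) μ).toReal / (ε / 4) ≤ t := by
        rw [div_le_iff₀ (by positivity), mul_comm]
        exact ENNReal.toReal_le_of_le_ofReal (by positivity) hr
      calc _ ≤ C * t ^ p := by gcongr
        _ ≤ C * t := by
          gcongr
          calc t ^ p ≤ t ^ (1 : ℝ) :=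
                Real.rpow_le_rpow_of_exponent_ge ht0 (min_le_left _ _) hp
            _ = t := Real.rpow_one t
        _ ≤ C * (η / C) := by gcongr; exact min_le_right _ _
        _ = η := by field_simp
  have all : ∀ᵐ x ∂μ, ∀ k : ℕ, ∃ N, ∀ n ≥ N, ∀ m ≥ N,
      |ergAvg S T (R n) f x - ergAvg S T (R m) f x| ≤ 1 / ((k : ℝ) + 1) :=
    ae_all_iff.2 fun k => main _ (by positivity)
  filter_upwards [all] with x hx
  refine cauchySeq_tendsto_of_complete (Metric.cauchySeq_iff.2 fun ε hε => ?_)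
  obtain ⟨k, hk⟩ := exists_nat_one_div_lt hε
  obtain ⟨N, hN⟩ := hx k
  exact ⟨N, fun n hn m hm => (hN n hn m hm).trans_lt hk⟩

lemma block {μ : Measure X} {S T : X ≃ᵐ X}
    (hsetup : ErgodicSetup μ S T) {R : ℕ → Rect}
    {p : ℝ} (hp : 1 ≤ p) (hw : ¬ IsWeakType μ (maxOp S T R) p) {η : ℝ} (hη : 0 < η) :
    ∃ g : X → ℝ, Measurable g ∧ (∀ x, 0 ≤ g x) ∧
      ∫⁻ x, ENNReal.ofReal (g x ^ p) ∂μ ≤ ENNReal.ofReal η ∧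
      ENNReal.ofReal (1 / 2) ≤ μ {x | 1 < maxOp S T R g x} := by
  have := hsetup.prob
  have hp0 : 0 < p := by linarith
  unfold IsWeakType at hw
  push Not at hw
  obtain ⟨f, hf, lam, hlam, hlt⟩ := hw (3 / η) (by positivity)
  let f1 : X → ℝ := fun y => lam⁻¹ * |hf.1.mk f y|
  have hf1m : Measurable f1 := (hf.1.stronglyMeasurable_mk.measurable.abs).const_mul _
  have hf1n : ∀ x, 0 ≤ f1 x := fun x => by simp only [f1]; positivity
  let E : Set X := {x | 1 < maxOp S T R f1 x}
  have hE : MeasurableSet E := measurableSet_lt measurable_const (maxOp_meas S T R hf1m)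
  have hsub : μ {x | ENNReal.ofReal lam < maxOp S T R f x} ≤ μ E := by
    refine measure_mono_ae ?_
    have h1 : ∀ᵐ x ∂μ, |f x| ≤ |lam * f1 x| := by
      filter_upwards [hf.1.ae_eq_mk] with x hx
      simp only [f1]
      rw [mul_inv_cancel_left₀ hlam.ne', abs_abs, ← hx]
    filter_upwards [maxOp_mono_ae hsetup h1 R] with x hx hx2
    have hx2 : ENNReal.ofReal lam < maxOp S T R f x := hx2
    rw [maxOp_const_mul S T R hlam.le] at hx
    change 1 < maxOp S T R f1 x
    by_contra hle
    rw [not_lt] at hle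
    exact absurd (hx2.trans_le (hx.trans (mul_le_mul_right hle _))) (by simp)
  have hnorm : eLpNorm f1 (ENNReal.ofReal p) μ = ENNReal.ofReal lam⁻¹ * eLpNorm f (ENNReal.ofReal p) μ := by
    have : eLpNorm f1 (ENNReal.ofReal p) μ = eLpNorm (lam⁻¹ • f) (ENNReal.ofReal p) μ := by
      refine eLpNorm_congr_norm_ae ?_
      filter_upwards [hf.1.ae_eq_mk] with x hx
      simp [f1, ← hx]
    rw [this, eLpNorm_const_smul, Real.enorm_of_nonneg (by positivity)]
  set J : ℝ := (eLpNorm f (ENNReal.ofReal p) μ).toReal / lam with hJ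
  have hJ0 : 0 ≤ J := by positivity
  have hI : ∫⁻ x, ENNReal.ofReal (f1 x ^ p) ∂μ = ENNReal.ofReal (J ^ p) := by
    have h1 := eLpNorm_pow (μ := μ) hp f1
    simp only [abs_of_nonneg (hf1n _)] at h1
    rw [← h1, hnorm, ← ENNReal.ofReal_rpow_of_nonneg hJ0 hp0.le, hJ, div_eq_inv_mul,
      ENNReal.ofReal_mul (by positivity), ENNReal.ofReal_toReal hf.2.ne]
  have hEe : μ E = ENNReal.ofReal (μ.real E) := (ofReal_measureReal).symm
  have hlt' : 3 / η * J ^ p < μ.real E := by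
    have := hlt.trans_le hsub
    rw [hEe] at this
    exact (ENNReal.ofReal_lt_ofReal_iff_of_nonneg (by positivity)).1 this
  have he0 : 0 < μ.real E := lt_of_le_of_lt (by positivity) hlt'
  have he1 : μ.real E ≤ 1 := measureReal_le_one
  obtain ⟨n, hn⟩ := covering hsetup.erg_S hE ⌈2 / μ.real E⌉₊ (by
    rw [← div_le_iff₀ he0]; exact Nat.le_ceil _)
  set m := ⌈2 / μ.real E⌉₊ with hm
  have hm3 : (m : ℝ) ≤ 3 / μ.real E := by
    have h1 := (Nat.ceil_lt_add_one (show 0 ≤ 2 / μ.real E by positivity)).le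
    have h2 : 1 ≤ 1 / μ.real E := by rw [le_div_iff₀ he0]; linarith
    have h3 : 3 / μ.real E = 2 / μ.real E + 1 / μ.real E := by ring
    rw [h3]; linarith
  let Q : X → ℝ := fun y => ∑ i ∈ Finset.range m, f1 (S^[n i] y) ^ p
  have hQn : ∀ y, 0 ≤ Q y := fun y => Finset.sum_nonneg fun i _ => Real.rpow_nonneg (hf1n _) _
  have hSm : Measurable S := S.measurable
  have hQm : Measurable Q := Finset.measurable_sum _ fun i _ =>
    (hf1m.comp (hSm.iterate (n i))).pow_const p
  refine ⟨fun y => Q y ^ (1 / p), hQm.pow_const _, fun y => Real.rpow_nonneg (hQn y) _, ?_, ?_⟩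
  · have e1 : ∀ x, (Q x ^ (1 / p)) ^ p = Q x := fun x => by
      rw [← Real.rpow_mul (hQn x), one_div_mul_cancel hp0.ne', Real.rpow_one]
    simp only [e1]
    have e2 : ∀ x, ENNReal.ofReal (Q x) = ∑ i ∈ Finset.range m, ENNReal.ofReal (f1 (S^[n i] x) ^ p) :=
      fun x => ENNReal.ofReal_sum_of_nonneg fun i _ => Real.rpow_nonneg (hf1n _) _
    simp only [e2]
    have hme : Measurable fun x => ENNReal.ofReal (f1 x ^ p) := (hf1m.pow_const p).ennreal_ofReal
    have hmi : ∀ i ∈ Finset.range m, Measurable fun x => ENNReal.ofReal (f1 (S^[n i] x) ^ p) :=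
      fun i _ => hme.comp (hSm.iterate (n i))
    rw [lintegral_finsetSum _ hmi]
    have e3 : ∀ i, ∫⁻ x, ENNReal.ofReal (f1 (S^[n i] x) ^ p) ∂μ = ENNReal.ofReal (J ^ p) := by
      intro i
      rw [← hI]
      exact (hsetup.measPres_S.iterate (n i)).lintegral_comp hme
    simp only [e3, Finset.sum_const, Finset.card_range, nsmul_eq_mul]
    rw [← ENNReal.ofReal_natCast, ← ENNReal.ofReal_mul (by positivity)]
    refine ENNReal.ofReal_le_ofReal ?_
    have h1 : J ^ p ≤ η / 3 * μ.real E := by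
      have : J ^ p = η / 3 * (3 / η * J ^ p) := by field_simp
      rw [this]; gcongr
    calc (m : ℝ) * J ^ p ≤ 3 / μ.real E * (η / 3 * μ.real E) := by gcongr
      _ = η := by field_simp
  · have h1 : ENNReal.ofReal (1 / 2) ≤ μ (⋃ i ∈ Finset.range m, S^[n i] ⁻¹' E) := by
      rw [← ofReal_measureReal (h := measure_ne_top _ _)]; exact ENNReal.ofReal_le_ofReal hn
    refine h1.trans (measure_mono_ae ?_)
    have h2 : ∀ᵐ x ∂μ, ∀ i ∈ Finset.range m, maxOp S T R (fun y => f1 (S^[n i] y)) x ≤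
        maxOp S T R (fun y => Q y ^ (1 / p)) x := by
      refine (ae_ball_iff (Finset.range m).countable_toSet).2 fun i hi => ?_
      refine maxOp_mono_ae hsetup (Eventually.of_forall fun y => ?_) R
      rw [abs_of_nonneg (hf1n _), abs_of_nonneg (Real.rpow_nonneg (hQn y) _)]
      have : f1 (S^[n i] y) = (f1 (S^[n i] y) ^ p) ^ (1 / p) := by
        rw [← Real.rpow_mul (hf1n _), mul_one_div_cancel hp0.ne', Real.rpow_one]
      rw [this]
      refine Real.rpow_le_rpow (Real.rpow_nonneg (hf1n _) _) ?_ (by positivity)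
      exact Finset.single_le_sum (f := fun i => f1 (S^[n i] y) ^ p)
        (fun i _ => Real.rpow_nonneg (hf1n _) _) hi
    filter_upwards [h2] with x hx hxU
    have hxU : x ∈ ⋃ i ∈ Finset.range m, S^[n i] ⁻¹' E := hxU
    simp only [mem_iUnion] at hxU
    obtain ⟨i, hi, hxE⟩ := hxU
    have hxE : 1 < maxOp S T R f1 (S^[n i] x) := hxE
    rw [← maxOp_comp hsetup.comm] at hxE
    exact hxE.trans_le (hx i hi)

lemma conv_imp_weak {μ : Measure X} {S T : X ≃ᵐ X}
    (hsetup : ErgodicSetup μ S T) {R : ℕ → Rect}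
    {p : ℝ} (hp : 1 ≤ p)
    (hc : ∀ f : X → ℝ, MemLp f (ENNReal.ofReal p) μ → AEConverges μ S T R f) :
    IsWeakType μ (maxOp S T R) p := by
  by_contra hw
  have := hsetup.prob
  have hp0 : 0 < p := by linarith
  have hb : ∀ k : ℕ, 0 < (1 / 2 : ℝ) ^ k * (((2 : ℝ) ^ k) ^ p)⁻¹ := fun k => by positivity
  choose g hgm hgn hgI hgμ using fun k => block hsetup hp hw (hb k)
  let G : X → ℝ≥0∞ := fun x => ∑' k, ENNReal.ofReal ((2 ^ k * g k x) ^ p)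
  have hGkm : ∀ k, Measurable fun x => ENNReal.ofReal ((2 ^ k * g k x) ^ p) := fun k =>
    (((hgm k).const_mul _).pow_const p).ennreal_ofReal
  have hGm : Measurable G := Measurable.ennreal_tsum hGkm
  have hGI : ∫⁻ x, G x ∂μ < ⊤ := by
    rw [lintegral_tsum fun k => (hGkm k).aemeasurable]
    have hk : ∀ k, ∫⁻ x, ENNReal.ofReal ((2 ^ k * g k x) ^ p) ∂μ ≤ ENNReal.ofReal ((1 / 2) ^ k) := by
      intro k
      have e : ∀ x, ENNReal.ofReal ((2 ^ k * g k x) ^ p) =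
          ENNReal.ofReal (((2 : ℝ) ^ k) ^ p) * ENNReal.ofReal (g k x ^ p) := fun x => by
        rw [Real.mul_rpow (by positivity) (hgn k x), ENNReal.ofReal_mul (by positivity)]
      simp only [e]
      rw [lintegral_const_mul _ ((hgm k).pow_const p).ennreal_ofReal]
      refine (mul_le_mul_right (hgI k) _).trans ?_
      rw [← ENNReal.ofReal_mul (by positivity)]
      refine ENNReal.ofReal_le_ofReal (le_of_eq ?_)
      field_simp
    refine (ENNReal.tsum_le_tsum hk).trans_lt ?_
    rw [← ENNReal.ofReal_tsum_of_nonneg (fun k => by positivity) summable_geometric_two]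
    exact ENNReal.ofReal_lt_top
  let F : X → ℝ := fun x => (G x).toReal ^ (1 / p)
  have hFm : Measurable F := hGm.ennreal_toReal.pow_const _
  have hFn : ∀ x, 0 ≤ F x := fun x => Real.rpow_nonneg ENNReal.toReal_nonneg _
  have hFp : ∀ x, F x ^ p = (G x).toReal := fun x => by
    simp only [F]
    rw [← Real.rpow_mul ENNReal.toReal_nonneg, one_div_mul_cancel hp0.ne', Real.rpow_one]
  have hFL : MemLp F (ENNReal.ofReal p) μ := by
    refine ⟨hFm.aestronglyMeasurable, ?_⟩
    have h1 : eLpNorm F (ENNReal.ofReal p) μ ^ p < ⊤ := by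
      rw [eLpNorm_pow hp]
      refine lt_of_le_of_lt (lintegral_mono fun x => ?_) hGI
      rw [abs_of_nonneg (hFn x), hFp]
      exact ENNReal.ofReal_toReal_le
    by_contra htop
    rw [not_lt, top_le_iff] at htop
    rw [htop, ENNReal.top_rpow_of_pos hp0] at h1
    exact lt_irrefl _ h1
  have hfin : ∀ᵐ x ∂μ, maxOp S T R F x < ⊤ := by
    filter_upwards [hc F hFL] with x hx
    obtain ⟨L, hL⟩ := hx
    exact maxOp_lt_top R hFn hL
  have hGfin : ∀ᵐ x ∂μ, G x < ⊤ := ae_lt_top hGm hGI.ne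
  have hdom : ∀ k, ∀ᵐ x ∂μ, maxOp S T R (fun y => 2 ^ k * g k y) x ≤ maxOp S T R F x := by
    intro k
    refine maxOp_mono_ae hsetup ?_ R
    filter_upwards [hGfin] with x hx
    have h0 : 0 ≤ 2 ^ k * g k x := mul_nonneg (by positivity) (hgn k x)
    rw [abs_of_nonneg h0, abs_of_nonneg (hFn x)]
    rw [← Real.rpow_le_rpow_iff h0 (hFn x) hp0, hFp]
    rw [← ENNReal.ofReal_le_iff_le_toReal hx.ne]
    exact ENNReal.le_tsum k
  let B : ℕ → Set X := fun k => {x | ENNReal.ofReal (2 ^ k) < maxOp S T R F x}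
  have hBm : ∀ k, MeasurableSet (B k) := fun k =>
    measurableSet_lt measurable_const (maxOp_meas S T R hFm)
  have hBμ : ∀ k, ENNReal.ofReal (1 / 2) ≤ μ (B k) := by
    intro k
    refine (hgμ k).trans (measure_mono_ae ?_)
    filter_upwards [hdom k] with x hx hx1
    have hx1 : 1 < maxOp S T R (g k) x := hx1
    rw [maxOp_const_mul S T R (by positivity)] at hx
    change ENNReal.ofReal (2 ^ k) < maxOp S T R F x
    refine lt_of_lt_of_le ?_ hx
    have hpos : ENNReal.ofReal (2 ^ k) ≠ 0 := by simp
    calc ENNReal.ofReal (2 ^ k) = ENNReal.ofReal (2 ^ k) * 1 := (mul_one _).symm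
      _ < _ := (ENNReal.mul_lt_mul_iff_right hpos ENNReal.ofReal_ne_top).2 hx1
  have hanti : Antitone B := by
    intro i j hij x hx
    refine lt_of_le_of_lt (ENNReal.ofReal_le_ofReal ?_) hx
    exact pow_le_pow_right₀ (by norm_num) hij
  have hlim := tendsto_measure_iInter_atTop (μ := μ) (fun k => (hBm k).nullMeasurableSet) hanti
    ⟨0, measure_ne_top _ _⟩
  have hge := ge_of_tendsto hlim (Eventually.of_forall hBμ)
  have hzero : μ (⋂ k, B k) = 0 := by
    refine measure_mono_null (t := {x | ¬ maxOp S T R F x < ⊤}) ?_ (ae_iff.1 hfin)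
    intro x hx hlt
    rw [mem_iInter] at hx
    obtain ⟨k, hk⟩ := pow_unbounded_of_one_lt (maxOp S T R F x).toReal (by norm_num : (1 : ℝ) < 2)
    have h1 : ENNReal.ofReal (2 ^ k) < maxOp S T R F x := hx k
    rw [ENNReal.ofReal_lt_iff_lt_toReal (by positivity) hlt.ne] at h1
    linarith
  rw [hzero] at hge
  simp at hge

/-- Sawyer–Stein principle: a.e. convergence of the averages `M_n f` for
all `f ∈ L^p` is equivalent to the weak-type `(p,p)` boundedness of `M*`. -/
theorem stmt3 {X : Type*} [MeasurableSpace X] (μ : Measure X) (S T : X ≃ᵐ X)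
    (hsetup : ErgodicSetup μ S T) (R : ℕ → Rect) (hR : IsProcess R)
    (p : ℝ) (hp : 1 ≤ p) :
    (∀ f : X → ℝ, MemLp f (ENNReal.ofReal p) μ → AEConverges μ S T R f) ↔
      IsWeakType μ (maxOp S T R) p := by
  exact ⟨conv_imp_weak hsetup hp, fun hw _ hf => weak_imp_conv hsetup hR hp hw hf⟩

end
end

section
/- Let Ω = {u_k^{−1}}_{k∈ℕ*}, where {u_k}_{k∈ℕ*} is an increasing sequence of nonnegative real numbers (with u_0 := 0) satisfying: (i) there exists c > 0 such that 1 + u_{k−1}² ≥ c(u_k − u_{k−1})² for all k ≥ 1; (ii) the Perron factor PF(Ω) = sup_{n∈ℕ} sup_{1≤l≤n} ((u_{n+2l}−u_{n+l})/(u_{n+l}−u_n) + (u_{n+l}−u_n)/(u_{n+2l}−u_{n+l})) is finite. Then there exists a collection of rectangles {R_k}_{k∈ℕ} in ℝ² containing (0,0) with l(R_k) → ∞ such that: (a) for each k ∈ ℕ*, the slope of the rectangle R_k is 1/u_k; (b) the discrete maximal operator A* associated to {R_k}_{k∈ℕ} does not satisfy a Tauberian condition. -/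
open MeasureTheory Filter Topology Set
open scoped ENNReal Pointwise BigOperators

noncomputable section

variable {X : Type*} [MeasurableSpace X]

section Aux

def mkR (u l K H : ℝ) (hl : 0 < l) (hK : 0 < K) (hH : 0 < H) : Rect where
  corner := (-(K * H * √(1 + u ^ 2))) • (Real.cos (Real.pi / 2 - Real.arctan u), Real.sin (Real.pi / 2 - Real.arctan u))
    + (-(H * l / √(1 + u ^ 2))) • (-Real.sin (Real.pi / 2 - Real.arctan u), Real.cos (Real.pi / 2 - Real.arctan u))
  angle := Real.pi / 2 - Real.arctan u
  len1 := 2 * (K * H * √(1 + u ^ 2))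
  len2 := 2 * (H * l / √(1 + u ^ 2))
  len1_pos := by positivity
  len2_pos := by positivity

lemma mem_mkR (u l K H : ℝ) (hl : 0 < l) (hK : 0 < K) (hH : 0 < H) (x y : ℝ) :
    (x, y) ∈ (mkR u l K H hl hK hH).carrier ↔
      |u * x + y| ≤ K * H * (1 + u ^ 2) ∧ |x - u * y| ≤ H * l := by
  have hq : 0 < √(1 + u ^ 2) := by positivity
  have hq2 : √(1 + u ^ 2) ^ 2 = 1 + u ^ 2 := Real.sq_sqrt (by positivity)
  unfold Rect.carrier mkR
  simp only [Real.cos_pi_div_two_sub, Real.sin_pi_div_two_sub, Real.sin_arctan, Real.cos_arctan]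
  set q := √(1 + u ^ 2) with hqd
  rw [← hq2]
  have hu2 : u ^ 2 = q ^ 2 - 1 := by linarith
  clear_value q
  simp only [mem_ofPred_eq, mem_Icc, Prod.smul_mk, smul_eq_mul, Prod.mk_add_mk, Prod.mk.injEq]
  constructor
  · rintro ⟨s, t, ⟨hs0, hs1⟩, ⟨ht0, ht1⟩, hx, hy⟩
    have e1 : u * x + y = q * (s - K * H * q) := by
      rw [hx, hy]; field_simp; linear_combination q * (s - K * H * q) * hu2
    have e2 : x - u * y = - q * (t - H * l / q) := by
      rw [hx, hy]; field_simp; linear_combination (H * l - t * q) * hu2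
    constructor
    · rw [e1, abs_mul, abs_of_pos hq]
      have : |s - K * H * q| ≤ K * H * q := abs_le.2 ⟨by linarith, by linarith⟩
      nlinarith
    · rw [e2, abs_mul, abs_neg, abs_of_pos hq]
      have : |t - H * l / q| ≤ H * l / q := abs_le.2 ⟨by linarith, by linarith⟩
      calc q * |t - H * l / q| ≤ q * (H * l / q) := by gcongr
        _ = H * l := by field_simp
  · rintro ⟨h1, h2⟩
    rw [abs_le] at h1 h2
    refine ⟨(u * x + y) / q + K * H * q, -(x - u * y) / q + H * l / q, ⟨?_, ?_⟩, ⟨?_, ?_⟩, ?_, ?_⟩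
    · have : -(K * H * q) ≤ (u * x + y) / q := by rw [le_div_iff₀ hq]; linarith [h1.1]
      linarith
    · have : (u * x + y) / q ≤ K * H * q := by rw [div_le_iff₀ hq]; linarith [h1.2]
      linarith
    · rw [← add_div]; apply div_nonneg _ hq.le; linarith
    · rw [← add_div, ← mul_div_assoc]; gcongr; linarith
    · field_simp; linear_combination (-x) * hu2
    · field_simp; linear_combination (-y) * hu2

lemma mkR_zero (u l K H : ℝ) (hl : 0 < l) (hK : 0 < K) (hH : 0 < H) :
    ((0:ℝ), (0:ℝ)) ∈ (mkR u l K H hl hK hH).carrier := by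
  rw [mem_mkR]; simp; constructor <;> positivity

lemma mkR_slope (u l K H : ℝ) (hl : 0 < l) (hK : 0 < K) (hH : 0 < H)
    (h : l ≤ K * (1 + u ^ 2)) : (mkR u l K H hl hK hH).slope = 1 / u := by
  have hq : 0 < √(1 + u ^ 2) := by positivity
  have hq2 : √(1 + u ^ 2) ^ 2 = 1 + u ^ 2 := Real.sq_sqrt (by positivity)
  unfold Rect.slope mkR
  simp only
  rw [if_pos, Real.tan_eq_sin_div_cos, Real.cos_pi_div_two_sub, Real.sin_pi_div_two_sub,
    Real.sin_arctan, Real.cos_arctan, div_div_div_cancel_right₀ hq.ne']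
  · gcongr 2 * ?_
    rw [div_le_iff₀ hq]
    calc H * l ≤ H * (K * (1 + u ^ 2)) := by gcongr
      _ = _ := by linear_combination (-(H * K)) * hq2

lemma mkR_short (u l K H : ℝ) (hl : 0 < l) (hK : 0 < K) (hH : 0 < H)
    (h : l ≤ K * (1 + u ^ 2)) (m : ℝ) (hm : m * √(1 + u ^ 2) ≤ H * l) :
    m ≤ (mkR u l K H hl hK hH).shortSide := by
  have hq : 0 < √(1 + u ^ 2) := by positivity
  have hq2 : √(1 + u ^ 2) ^ 2 = 1 + u ^ 2 := Real.sq_sqrt (by positivity)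
  unfold Rect.shortSide mkR
  simp only
  have h1 : m ≤ H * l / √(1 + u ^ 2) := by rwa [le_div_iff₀ hq]
  have h2 : H * l / √(1 + u ^ 2) ≤ K * H * √(1 + u ^ 2) := by
    rw [div_le_iff₀ hq]
    calc H * l ≤ H * (K * (1 + u ^ 2)) := by gcongr
      _ = _ := by linear_combination (-(H * K)) * hq2
  have h3 : 0 < H * l / √(1 + u ^ 2) := by positivity
  apply le_min <;> linarith

lemma card_Icc_le (a b : ℝ) (h : a ≤ b) : ((Finset.Icc ⌈a⌉ ⌊b⌋).card : ℝ) ≤ b - a + 1 := by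
  rw [Int.card_Icc]
  have h1 := Int.floor_le b
  have h2 := Int.le_ceil a
  have : (((⌊b⌋ + 1 - ⌈a⌉).toNat : ℤ) : ℝ) ≤ b - a + 1 := by
    rw [Int.toNat_eq_max]; push_cast
    apply max_le <;> linarith
  exact_mod_cast this

lemma card_Icc_ge (a b : ℝ) : b - a - 1 ≤ ((Finset.Icc ⌈a⌉ ⌊b⌋).card : ℝ) := by
  rw [Int.card_Icc]
  have h1 := Int.lt_floor_add_one b
  have h2 := Int.ceil_lt_add_one a
  have : b - a - 1 ≤ (((⌊b⌋ + 1 - ⌈a⌉).toNat : ℤ) : ℝ) := by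
    rw [Int.toNat_eq_max]; push_cast
    apply le_max_of_le_left; linarith
  exact_mod_cast this

lemma card_Ico_ge (a b : ℝ) : b - a - 1 ≤ ((Finset.Ico ⌈a⌉ ⌈b⌉).card : ℝ) := by
  rw [Int.card_Ico]
  have h1 := Int.le_ceil b
  have h2 := Int.ceil_lt_add_one a
  have : b - a - 1 ≤ (((⌈b⌉ - ⌈a⌉).toNat : ℤ) : ℝ) := by
    rw [Int.toNat_eq_max]; push_cast
    apply le_max_of_le_left; linarith
  exact_mod_cast this

def rowsF (I : Finset ℤ) (r : ℤ → Finset ℤ) : Finset (ℤ × ℤ) :=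
  (I.sigma r).image (fun p => (p.2, p.1))

lemma mem_rowsF (I : Finset ℤ) (r : ℤ → Finset ℤ) (p : ℤ × ℤ) :
    p ∈ rowsF I r ↔ p.2 ∈ I ∧ p.1 ∈ r p.2 := by
  unfold rowsF
  simp only [Finset.mem_image, Finset.mem_sigma]
  constructor
  · rintro ⟨a, ha, rfl⟩; exact ha
  · intro h; exact ⟨⟨p.2, p.1⟩, h, rfl⟩

lemma card_rowsF (I : Finset ℤ) (r : ℤ → Finset ℤ) :
    (rowsF I r).card = ∑ y ∈ I, (r y).card := by
  unfold rowsF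
  rw [Finset.card_image_of_injective, Finset.card_sigma]
  rintro ⟨a, b⟩ ⟨c, d⟩ h
  simp only [Prod.mk.injEq] at h
  obtain ⟨rfl, rfl⟩ := h
  rfl

/-- the lattice points of `mkR` are in an explicit finite set -/
lemma lattice_mkR (u l K H C : ℝ) (hl : 0 < l) (hK : 0 < K) (hH : 0 < H) (hC : 0 ≤ C)
    (hul : u * l ≤ C * (1 + u ^ 2)) (hu : 0 ≤ u) (hKC : C ≤ K) :
    latticePts (mkR u l K H hl hK hH).carrier ⊆
      (rowsF (Finset.Icc ⌈-(2 * K * H)⌉ ⌊2 * K * H⌋)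
        (fun y => Finset.Icc ⌈u * y - H * l⌉ ⌊u * y + H * l⌋) : Finset (ℤ × ℤ)) := by
  rintro ⟨x, y⟩ h
  unfold latticePts at h
  rw [mem_ofPred_eq, mem_mkR] at h
  obtain ⟨h1, h2⟩ := h
  simp only at h1 h2
  rw [Finset.mem_coe, mem_rowsF]
  simp only [Finset.mem_Icc, Int.ceil_le, Int.le_floor]
  rw [abs_le] at h1 h2
  have hq : 0 < 1 + u ^ 2 := by positivity
  have e : (1 + u ^ 2) * (y:ℝ) = (u * x + y) - u * (x - u * y) := by ring
  have h3 : u * (x - u * y) ≤ u * (H * l) := by gcongr; exact h2.2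
  have h4 : u * (-(H * l)) ≤ u * (x - u * y) := by gcongr; exact h2.1
  have h5 : u * (H * l) ≤ K * H * (1 + u ^ 2) := by
    calc u * (H * l) = H * (u * l) := by ring
      _ ≤ H * (C * (1 + u ^ 2)) := by gcongr
      _ ≤ H * (K * (1 + u ^ 2)) := by gcongr
      _ = _ := by ring
  refine ⟨⟨?_, ?_⟩, by linarith, by linarith⟩
  · by_contra hc; push Not at hc
    have := mul_lt_mul_of_pos_left hc hq
    linarith
  · by_contra hc; push Not at hc
    have := mul_lt_mul_of_pos_left hc hq
    linarith

lemma count_mkR (u l K H C : ℝ) (hl : 0 < l) (hK : 0 < K) (hH : 0 < H) (hC : 0 ≤ C)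
    (hul : u * l ≤ C * (1 + u ^ 2)) (hu : 0 ≤ u) (hKC : C ≤ K) (h1 : 1 ≤ K * H) (h2 : 1 ≤ H * l) :
    (latticeCount (mkR u l K H hl hK hH).carrier : ℝ) ≤ 15 * K * H * (H * l) := by
  have h := lattice_mkR u l K H C hl hK hH hC hul hu hKC
  have h' := Set.ncard_le_ncard h (Finset.finite_toSet _)
  rw [Set.ncard_coe_finset, card_rowsF] at h'
  have h'' : (latticeCount (mkR u l K H hl hK hH).carrier : ℝ) ≤
      ((∑ y ∈ Finset.Icc ⌈-(2 * K * H)⌉ ⌊2 * K * H⌋,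
        (Finset.Icc ⌈u * y - H * l⌉ ⌊u * y + H * l⌋).card : ℕ) : ℝ) := by exact_mod_cast h'
  refine h''.trans ?_
  push_cast
  calc _ ≤ ∑ y ∈ Finset.Icc ⌈-(2 * K * H)⌉ ⌊2 * K * H⌋, (3 * (H * l)) := by
        apply Finset.sum_le_sum
        intro y _
        refine (card_Icc_le _ _ (by linarith)).trans (by linarith)
    _ = ((Finset.Icc ⌈-(2 * K * H)⌉ ⌊2 * K * H⌋).card : ℝ) * (3 * (H * l)) := by
        rw [Finset.sum_const, nsmul_eq_mul]
    _ ≤ (5 * K * H) * (3 * (H * l)) := by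
        gcongr
        refine (card_Icc_le _ _ (by linarith)).trans (by linarith)
    _ = _ := by ring

lemma avg_mkR (u l K C : ℝ) (H : ℕ) (hl : 0 < l) (hK : 0 < K) (hH : 0 < (H:ℝ)) (hC : 0 ≤ C)
    (hul : u * l ≤ C * (1 + u ^ 2)) (hu : 0 ≤ u) (hKC : C + 4 ≤ K) (h2 : 2 ≤ H * l)
    (E : Finset (ℤ × ℤ)) (c : ℝ)
    (hE : ∀ X Y : ℤ, -(2 * H : ℤ) ≤ Y → Y < -(H:ℤ) → c + u * Y ≤ X → X ≤ c + u * Y + H * l →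
      (X, Y) ∈ E)
    (X Y : ℤ) (hY : (H:ℤ) ≤ Y) (hY' : Y < 2 * H) (hX : c + u * Y ≤ X) (hX' : X ≤ c + u * Y + H * l) :
    1 / (30 * K) ≤ discAvg (mkR u l K H hl hK hH) (fun q => |if q ∈ E then (1 : ℝ) else 0|) (X, Y) := by
  have hH1 : (1:ℝ) ≤ H := by exact_mod_cast hH
  have hsub := lattice_mkR u l K H C hl hK hH hC hul hu (by linarith)
  have hfin : (latticePts (mkR u l K H hl hK hH).carrier).Finite :=
    (Finset.finite_toSet _).subset hsub
  have hcount := count_mkR u l K H C hl hK hH hC hul hu (by linarith) (by nlinarith) (by linarith)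
  unfold discAvg
  set L := latticePts (mkR u l K H hl hK hH).carrier with hL
  set F := rowsF (Finset.Ico (-(2 * H : ℤ)) (-(H:ℤ)))
    (fun y => Finset.Icc ⌈c + u * y⌉ ⌊c + u * y + H * l⌋) with hF
  have hFc : H * (H * l) / 2 ≤ (F.card : ℝ) := by
    rw [hF, card_rowsF]; push_cast
    calc H * (H * l) / 2 = ∑ y ∈ (Finset.Ico (-(2 * H : ℤ)) (-(H:ℤ))), (H * l / 2) := by
          rw [Finset.sum_const, nsmul_eq_mul, Int.card_Ico]
          have : (-(H:ℤ) - -(2 * H : ℤ)).toNat = H := by omega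
          rw [this]; ring
      _ ≤ _ := by
          apply Finset.sum_le_sum
          intro y _
          refine le_trans ?_ (card_Icc_ge _ _)
          linarith
  rw [finsum_mem_eq_finite_toFinset_sum _ hfin]
  have hle : (F.card : ℝ) ≤ ∑ p ∈ hfin.toFinset, |if (X + p.1, Y + p.2) ∈ E then (1:ℝ) else 0| := by
    have hinj : Function.Injective (fun p : ℤ × ℤ => (p.1 - X, p.2 - Y)) := by
      rintro ⟨a, b⟩ ⟨c, d⟩ h
      simp only [Prod.mk.injEq] at h ⊢
      omega
    rw [← Finset.card_image_of_injective F hinj, Finset.card_eq_sum_ones]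
    push_cast
    have hFm : ∀ p ∈ F, -(2 * H : ℤ) ≤ p.2 ∧ p.2 < -(H:ℤ) ∧ c + u * p.2 ≤ p.1 ∧ p.1 ≤ c + u * p.2 + H * l := by
      intro p hp
      rw [hF, mem_rowsF] at hp
      simp only [Finset.mem_Icc, Finset.mem_Ico, Int.ceil_le, Int.le_floor] at hp
      tauto
    calc _ ≤ ∑ p ∈ F.image (fun p : ℤ × ℤ => (p.1 - X, p.2 - Y)), |if (X + p.1, Y + p.2) ∈ E then (1:ℝ) else 0| := by
          apply Finset.sum_le_sum
          intro p hp
          rw [Finset.mem_image] at hp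
          obtain ⟨r, hr, rfl⟩ := hp
          obtain ⟨a, b, c, d⟩ := hFm r hr
          simp only [add_sub_cancel]
          rw [if_pos (hE r.1 r.2 a b c d)]; simp
      _ ≤ _ := by
          apply Finset.sum_le_sum_of_subset_of_nonneg
          · intro p hp
            rw [Finset.mem_image] at hp
            obtain ⟨r, hr, rfl⟩ := hp
            obtain ⟨a, b, c', d⟩ := hFm r hr
            rw [Set.Finite.mem_toFinset, hL]
            unfold latticePts
            rw [mem_ofPred_eq, mem_mkR]
            have a' : (-(2 * H) : ℝ) ≤ r.2 := by exact_mod_cast a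
            have b' : (r.2 : ℝ) < -H := by exact_mod_cast b
            have hYr : (H:ℝ) ≤ Y := by exact_mod_cast hY
            have hYr' : (Y:ℝ) < 2 * H := by exact_mod_cast hY'
            push_cast
            have hh : |((r.1:ℝ) - X) - u * (r.2 - Y)| ≤ H * l := abs_le.2 ⟨by linarith, by linarith⟩
            refine ⟨?_, hh⟩
            have e : u * ((r.1:ℝ) - X) + (r.2 - Y) = u * (((r.1:ℝ) - X) - u * (r.2 - Y)) + (1 + u ^ 2) * (r.2 - Y) := by ring
            rw [e]
            refine (abs_add_le _ _).trans ?_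
            rw [abs_mul, abs_mul, abs_of_nonneg hu, abs_of_pos (show 0 < 1 + u ^ 2 by positivity)]
            have hy : |(r.2:ℝ) - Y| ≤ 4 * H := abs_le.2 ⟨by linarith, by linarith⟩
            calc _ ≤ u * (H * l) + (1 + u ^ 2) * (4 * H) := by gcongr
              _ = H * (u * l) + (1 + u ^ 2) * (4 * H) := by ring
              _ ≤ H * (C * (1 + u ^ 2)) + (1 + u ^ 2) * (4 * H) := by gcongr
              _ = (C + 4) * H * (1 + u ^ 2) := by ring
              _ ≤ _ := by gcongr
          · intros; positivity
  have hcpos : 0 < (latticeCount (mkR u l K H hl hK hH).carrier : ℝ) := by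
    have : ((0:ℤ), (0:ℤ)) ∈ L := by
      rw [hL]; unfold latticePts; simpa using mkR_zero u l K H hl hK hH
    have : 0 < L.ncard := (Set.ncard_pos hfin).2 ⟨_, this⟩
    exact_mod_cast this
  rw [inv_mul_eq_div, div_le_div_iff₀ (by positivity) hcpos]
  have := hFc.trans hle
  calc _ ≤ 15 * K * H * (H * l) := by linarith
    _ = (H * (H * l) / 2) * (30 * K) := by ring
    _ ≤ _ := by gcongr
end Aux
section Aux2

def Dl (u : ℕ → ℝ) (m b : ℕ) : ℝ := u (2 ^ m * (b + 1)) - u (2 ^ m * b)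

def aOff (u : ℕ → ℝ) (M k : ℕ) : ℝ := ∑ m ∈ Finset.range M, u (2 ^ (m + 1) * (k / 2 ^ (m + 1)))

def Zc (u : ℕ → ℝ) (M j : ℕ) (t : ℝ) (b : ℕ) : ℝ :=
  -(t - j) * u (2 ^ j * b) + ∑ m ∈ Finset.Ico j M, u (2 ^ (m + 1) * (b / 2 ^ (m + 1 - j)))

def PFB (u : ℕ → ℝ) (B : ℝ) : Prop := ∀ n l : ℕ, 1 ≤ l → l ≤ n →
      (u (n + 2 * l) - u (n + l)) / (u (n + l) - u n) +
        (u (n + l) - u n) / (u (n + 2 * l) - u (n + l)) ≤ B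

lemma tele (f : ℕ → ℝ) (a b : ℕ) (h : a ≤ b) :
    ∑ k ∈ Finset.Ico a b, (f (k + 1) - f k) = f b - f a := by
  induction b, h using Nat.le_induction with
  | base => simp
  | succ n hn ih => rw [Finset.sum_Ico_succ_top hn, ih]; ring

lemma Dl_nonneg {u : ℕ → ℝ} (hm : StrictMono u) (m b : ℕ) : 0 ≤ Dl u m b := by
  unfold Dl
  exact sub_nonneg.2 (hm.monotone (by gcongr; omega))

lemma Dl_step {u : ℕ → ℝ} (hm : StrictMono u) {B : ℝ} (hP : PFB u B) (M m k : ℕ)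
    (hk : 2 ^ M ≤ k) (hmM : m + 1 ≤ M) :
    (B + 1) * Dl u m (k / 2 ^ m) ≤ B * Dl u (m + 1) (k / 2 ^ (m + 1)) := by
  have hdiv : k / 2 ^ (m + 1) = k / 2 ^ m / 2 := by rw [Nat.div_div_eq_div_mul, pow_succ]
  set b := k / 2 ^ (m + 1) with hb
  have hl : 1 ≤ 2 ^ m := Nat.one_le_two_pow
  have hb1 : 1 ≤ b := by
    rw [hb, Nat.one_le_div_iff (by positivity)]
    exact (Nat.pow_le_pow_right (by norm_num) hmM).trans hk
  have hn : 2 ^ m ≤ 2 ^ (m + 1) * b := by rw [pow_succ]; nlinarith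
  have h := hP (2 ^ (m + 1) * b) (2 ^ m) hl hn
  have e2 : 2 ^ (m + 1) * b + 2 * 2 ^ m = 2 ^ (m + 1) * (b + 1) := by ring
  have e1 : 2 ^ (m + 1) * b + 2 ^ m = 2 ^ m * (2 * b + 1) := by ring
  have e0 : 2 ^ (m + 1) * b = 2 ^ m * (2 * b) := by ring
  rw [e2] at h
  have hx : 0 < u (2 ^ (m + 1) * b + 2 ^ m) - u (2 ^ (m + 1) * b) := sub_pos.2 (hm (by omega))
  have hy : 0 < u (2 ^ (m + 1) * (b + 1)) - u (2 ^ (m + 1) * b + 2 ^ m) :=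
    sub_pos.2 (hm (by omega))
  have hD : Dl u (m + 1) b = (u (2 ^ (m + 1) * b + 2 ^ m) - u (2 ^ (m + 1) * b)) +
    (u (2 ^ (m + 1) * (b + 1)) - u (2 ^ (m + 1) * b + 2 ^ m)) := by unfold Dl; ring
  have hcase : Dl u m (k / 2 ^ m) = u (2 ^ (m + 1) * b + 2 ^ m) - u (2 ^ (m + 1) * b) ∨
      Dl u m (k / 2 ^ m) = u (2 ^ (m + 1) * (b + 1)) - u (2 ^ (m + 1) * b + 2 ^ m) := by
    rcases (by omega : k / 2 ^ m = 2 * b ∨ k / 2 ^ m = 2 * b + 1) with h | h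
    · left; rw [h]; unfold Dl; rw [e1, e0]
    · right; rw [h]; unfold Dl
      rw [e1, show 2 * b + 1 + 1 = 2 * (b + 1) by ring, show 2 ^ (m + 1) * (b + 1) = 2 ^ m * (2 * (b + 1)) by ring]
  rw [hD]
  set x := u (2 ^ (m + 1) * b + 2 ^ m) - u (2 ^ (m + 1) * b)
  set y := u (2 ^ (m + 1) * (b + 1)) - u (2 ^ (m + 1) * b + 2 ^ m)
  have h1 : y / x ≤ B := by have : 0 < x / y := by positivity
                            linarith
  have h2 : x / y ≤ B := by have : 0 < y / x := by positivity
                            linarith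
  rw [div_le_iff₀ hx] at h1
  rw [div_le_iff₀ hy] at h2
  rcases hcase with h | h <;> rw [h] <;> linarith

lemma Dl_sum {u : ℕ → ℝ} (hm : StrictMono u) {B : ℝ} (hB : 0 < B) (hP : PFB u B) (M k : ℕ)
    (hk : 2 ^ M ≤ k) (j : ℕ) (hj : j ≤ M) :
    ∑ m ∈ Finset.range j, Dl u (m + 1) (k / 2 ^ (m + 1)) ≤ (B + 1) * Dl u j (k / 2 ^ j) := by
  induction j with
  | zero => simp; have := Dl_nonneg hm 0 k; positivity
  | succ j ih =>
    rw [Finset.sum_range_succ]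
    have h1 := ih (by omega)
    have h2 := Dl_step hm hP M j k hk hj
    linarith

lemma Dl_leaf {u : ℕ → ℝ} (hm : StrictMono u) {B : ℝ} (hB : 0 < B) (hP : PFB u B) (M k : ℕ)
    (hk : 2 ^ M ≤ k) (j : ℕ) (hj : j ≤ M) :
    (B + j) * (u (k + 1) - u k) ≤ B * Dl u j (k / 2 ^ j) := by
  induction j with
  | zero => simp [Dl]
  | succ j ih =>
    have h1 := ih (by omega)
    have h2 := Dl_step hm hP M j k hk hj
    have hl : 0 < u (k + 1) - u k := sub_pos.2 (hm (by omega))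
    push_cast
    have : (B + 1) * ((B + j) * (u (k + 1) - u k)) ≤ B * (B * Dl u (j+1) (k / 2 ^ (j+1))) := by
      calc _ ≤ (B + 1) * (B * Dl u j (k / 2 ^ j)) := by gcongr
        _ = B * ((B + 1) * Dl u j (k / 2 ^ j)) := by ring
        _ ≤ _ := by gcongr
    have h3 : B * ((B + (j + 1)) * (u (k + 1) - u k)) ≤ (B + 1) * ((B + j) * (u (k + 1) - u k)) := by
      have : (0:ℝ) ≤ j * (u (k + 1) - u k) := by positivity
      nlinarith
    exact le_of_mul_le_mul_left (h3.trans this) hB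

lemma div_bounds (k j : ℕ) : 2 ^ j * (k / 2 ^ j) ≤ k ∧ k < 2 ^ j * (k / 2 ^ j + 1) :=
  ⟨Nat.mul_div_le k _, by
    have := Nat.lt_mul_div_succ k (show 0 < 2 ^ j by positivity)
    simpa using this⟩

lemma cover {u : ℕ → ℝ} (hm : StrictMono u) {B : ℝ} (hB : 0 < B) (hP : PFB u B) (M k : ℕ)
    (hk : 2 ^ M ≤ k) (j : ℕ) (hj : j ≤ M) (t : ℝ) (h1 : (j:ℝ) ≤ t) (h2 : t ≤ j + 1) :
    Zc u M j t (k / 2 ^ j) - (B + 2) * Dl u j (k / 2 ^ j) ≤ aOff u M k - t * u k ∧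
      aOff u M k - t * u k ≤ Zc u M j t (k / 2 ^ j) := by
  have hs : aOff u M k = ∑ m ∈ Finset.range j, u (2 ^ (m + 1) * (k / 2 ^ (m + 1))) +
      ∑ m ∈ Finset.Ico j M, u (2 ^ (m + 1) * (k / 2 ^ j / 2 ^ (m + 1 - j))) := by
    unfold aOff
    rw [← Finset.sum_range_add_sum_Ico _ hj]
    congr 1
    apply Finset.sum_congr rfl
    intro m hm
    rw [Finset.mem_Ico] at hm
    rw [Nat.div_div_eq_div_mul, ← pow_add]
    congr 4; omega
  have up : ∑ m ∈ Finset.range j, u (2 ^ (m + 1) * (k / 2 ^ (m + 1))) ≤ j * u k := by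
    calc _ ≤ ∑ m ∈ Finset.range j, u k :=
          Finset.sum_le_sum fun m _ => hm.monotone (div_bounds k (m + 1)).1
      _ = _ := by simp
  have lo : j * u k - (B + 1) * Dl u j (k / 2 ^ j) ≤
      ∑ m ∈ Finset.range j, u (2 ^ (m + 1) * (k / 2 ^ (m + 1))) := by
    have h := Dl_sum hm hB hP M k hk j hj
    have : ∑ m ∈ Finset.range j, u k ≤ ∑ m ∈ Finset.range j, (u (2 ^ (m + 1) * (k / 2 ^ (m + 1))) +
        Dl u (m + 1) (k / 2 ^ (m + 1))) := by
      apply Finset.sum_le_sum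
      intro m _
      have := hm (div_bounds k (m + 1)).2
      unfold Dl; linarith
    rw [Finset.sum_add_distrib] at this
    simp only [Finset.sum_const, Finset.card_range, nsmul_eq_mul] at this
    linarith
  have b1 := hm.monotone (div_bounds k j).1
  have b2 := (hm (div_bounds k j).2).le
  have b3 : u k - u (2 ^ j * (k / 2 ^ j)) ≤ Dl u j (k / 2 ^ j) := by unfold Dl; linarith
  have hD := Dl_nonneg hm j (k / 2 ^ j)
  rw [hs]; unfold Zc
  constructor
  · nlinarith
  · nlinarith

lemma aOff_mono {u : ℕ → ℝ} (hm : StrictMono u) (M : ℕ) : Monotone (aOff u M) := by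
  intro k k' h
  unfold aOff
  apply Finset.sum_le_sum
  intro m _
  apply hm.monotone
  gcongr

def alp (u : ℕ → ℝ) (N H k : ℕ) (Y : ℤ) : ℝ := (H / N : ℝ) * aOff u (2 * N) k + u k * Y

def EE (u : ℕ → ℝ) (N H : ℕ) : Finset (ℤ × ℤ) :=
  rowsF (Finset.Ico (-(2 * H : ℤ)) (-(H:ℤ))) (fun Y =>
    (Finset.Ico (2 ^ (2 * N)) (2 ^ (2 * N + 1))).biUnion fun k =>
      Finset.Icc ⌈alp u N H k Y⌉ ⌊alp u N H k Y + H * (u (k + 1) - u k)⌋)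

def WW (u : ℕ → ℝ) (N H : ℕ) : Finset (ℤ × ℤ) :=
  rowsF (Finset.Ico (H : ℤ) (2 * H : ℤ)) (fun Y =>
    (Finset.Ico (2 ^ (2 * N)) (2 ^ (2 * N + 1))).biUnion fun k =>
      Finset.Ico ⌈alp u N H k Y⌉ ⌈alp u N H k Y + H * (u (k + 1) - u k)⌉)

lemma WW_card {u : ℕ → ℝ} (hm : StrictMono u) (N H : ℕ)
    (hH : ∀ k ∈ Finset.Ico (2 ^ (2 * N)) (2 ^ (2 * N + 1)), 2 ≤ H * (u (k + 1) - u k)) :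
    H * (H * (u (2 ^ (2 * N + 1)) - u (2 ^ (2 * N))) / 2) ≤ ((WW u N H).card : ℝ) := by
  unfold WW
  rw [card_rowsF]; push_cast
  calc _ = ∑ y ∈ (Finset.Ico (H:ℤ) (2 * H : ℤ)), (H * (u (2 ^ (2 * N + 1)) - u (2 ^ (2 * N))) / 2) := by
        rw [Finset.sum_const, nsmul_eq_mul, Int.card_Ico]
        have : ((2 * H : ℤ) - (H:ℤ)).toNat = H := by omega
        rw [this]
    _ ≤ _ := by
        apply Finset.sum_le_sum
        intro Y hY
        rw [Finset.mem_Ico] at hY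
        have hYr : (H:ℝ) ≤ Y := by exact_mod_cast hY.1
        rw [Finset.card_biUnion]
        · push_cast
          rw [← tele u _ _ (Nat.pow_le_pow_right (by norm_num) (Nat.le_succ _)), Finset.mul_sum, Finset.sum_div]
          apply Finset.sum_le_sum
          intro k hk
          refine le_trans ?_ (card_Ico_ge _ _)
          have := hH k hk
          linarith
        · have key : ∀ k k' : ℕ, k < k' → alp u N H k Y + H * (u (k + 1) - u k) ≤ alp u N H k' Y := by
            intro k k' h
            unfold alp
            have h1 : (H / N : ℝ) * aOff u (2 * N) k ≤ (H / N : ℝ) * aOff u (2 * N) k' := by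
              gcongr; exact aOff_mono hm _ h.le
            have h2 : u (k + 1) ≤ u k' := hm.monotone h
            have h3 : u k < u (k + 1) := hm (by omega)
            have h4 : (H:ℝ) * (u (k + 1) - u k) ≤ Y * (u k' - u k) := by
              apply mul_le_mul hYr _ _ _ <;> linarith [Nat.cast_nonneg (α := ℝ) H]
            linarith
          intro k _ k' _ hne
          have dj : ∀ k k' : ℕ, k < k' → Disjoint (Finset.Ico ⌈alp u N H k Y⌉ ⌈alp u N H k Y + H * (u (k + 1) - u k)⌉) (Finset.Ico ⌈alp u N H k' Y⌉ ⌈alp u N H k' Y + H * (u (k' + 1) - u k')⌉) := by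
            intro k k' h
            rw [Finset.disjoint_left]
            intro x hx hx'
            rw [Finset.mem_Ico] at hx hx'
            have := Int.ceil_le_ceil (key k k' h)
            omega
          rcases lt_or_gt_of_ne hne with h | h
          · exact dj k k' h
          · exact (dj k' k h).symm

lemma EE_row {u : ℕ → ℝ} (hm : StrictMono u) {B : ℝ} (hB : 0 < B) (hP : PFB u B) (N H : ℕ)
    (hN : 1 ≤ N) (hH0 : 1 ≤ H)
    (hH : ∀ k ∈ Finset.Ico (2 ^ (2 * N)) (2 ^ (2 * N + 1)), (N:ℝ) ≤ H * (u (k + 1) - u k))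
    (Y : ℤ) (hY1 : -(2 * H : ℤ) ≤ Y) (hY2 : Y < -(H:ℤ)) :
    (((Finset.Ico (2 ^ (2 * N)) (2 ^ (2 * N + 1))).biUnion fun k =>
      Finset.Icc ⌈alp u N H k Y⌉ ⌊alp u N H k Y + H * (u (k + 1) - u k)⌋).card : ℝ) ≤
    (2 * B + 3) * (H / N) * (u (2 ^ (2 * N + 1)) - u (2 ^ (2 * N))) := by
  have hNr : (0:ℝ) < N := by exact_mod_cast hN
  have hHr : (0:ℝ) < H := by exact_mod_cast hH0
  set σ : ℝ := H / N with hσ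
  have hσ0 : 0 < σ := by positivity
  have hσN : σ * N = H := by rw [hσ]; field_simp
  set t : ℝ := -Y / σ with ht
  have htσ : σ * t = -Y := by rw [ht]; field_simp
  have hY1r : (-(2 * H) : ℝ) ≤ Y := by exact_mod_cast hY1
  have hY2r : (Y : ℝ) < -H := by exact_mod_cast hY2
  have htN : (N:ℝ) ≤ t := by rw [ht, le_div_iff₀ hσ0]; linarith
  have ht2N : t ≤ ((2 * N : ℕ) : ℝ) := by rw [ht, div_le_iff₀ hσ0]; push_cast; linarith
  set j := ⌊t⌋₊ with hj
  have hjN : N ≤ j := Nat.le_floor htN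
  have hj2 : j ≤ 2 * N := Nat.floor_le_of_le ht2N
  have hjt : (j:ℝ) ≤ t := Nat.floor_le (by linarith)
  have hjt' : t ≤ j + 1 := (Nat.lt_floor_add_one t).le
  have hjNr : (N:ℝ) ≤ j := by exact_mod_cast hjN
  set Bl := Finset.Ico (2 ^ (2 * N - j)) (2 ^ (2 * N + 1 - j)) with hBl
  have p1 : 2 ^ j * 2 ^ (2 * N - j) = 2 ^ (2 * N) := by rw [← pow_add]; congr 1; omega
  have p2 : 2 ^ j * 2 ^ (2 * N + 1 - j) = 2 ^ (2 * N + 1) := by rw [← pow_add]; congr 1; omega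
  have hsub : ((Finset.Ico (2 ^ (2 * N)) (2 ^ (2 * N + 1))).biUnion fun k =>
      Finset.Icc ⌈alp u N H k Y⌉ ⌊alp u N H k Y + H * (u (k + 1) - u k)⌋) ⊆
      Bl.biUnion fun b => Finset.Icc ⌈σ * (Zc u (2 * N) j t b - (B + 2) * Dl u j b)⌉
        ⌊σ * (Zc u (2 * N) j t b + B * Dl u j b)⌋ := by
    intro X hX
    rw [Finset.mem_biUnion] at hX ⊢
    obtain ⟨k, hk, hX⟩ := hX
    rw [Finset.mem_Ico] at hk
    refine ⟨k / 2 ^ j, ?_, ?_⟩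
    · rw [hBl, Finset.mem_Ico, Nat.le_div_iff_mul_le (by positivity), Nat.div_lt_iff_lt_mul (by positivity),
        mul_comm _ (2 ^ j), p1, mul_comm _ (2 ^ j), p2]
      exact hk
    · have hc := cover hm hB hP (2 * N) k hk.1 j hj2 t hjt hjt'
      have hleaf := Dl_leaf hm hB hP (2 * N) k hk.1 j hj2
      have hl : 0 < u (k + 1) - u k := sub_pos.2 (hm (by omega))
      have ha : alp u N H k Y = σ * (aOff u (2 * N) k - t * u k) := by
        unfold alp; linear_combination u k * htσ
      have hw : H * (u (k + 1) - u k) ≤ σ * (B * Dl u j (k / 2 ^ j)) := by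
        rw [← hσN, mul_assoc]
        refine mul_le_mul_of_nonneg_left (le_trans ?_ hleaf) hσ0.le
        gcongr
        linarith
      rw [Finset.mem_Icc, Int.ceil_le, Int.le_floor] at hX ⊢
      have c1 := mul_le_mul_of_nonneg_left hc.1 hσ0.le
      have c2 := mul_le_mul_of_nonneg_left hc.2 hσ0.le
      constructor
      · linarith [hX.1]
      · linarith [hX.2]
  have hL : ∑ b ∈ Bl, Dl u j b = u (2 ^ (2 * N + 1)) - u (2 ^ (2 * N)) := by
    have := tele (fun b => u (2 ^ j * b)) (2 ^ (2 * N - j)) (2 ^ (2 * N + 1 - j))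
      (Nat.pow_le_pow_right (by norm_num) (by omega))
    simp only [p1, p2] at this
    rw [← this]; rfl
  have hcardB : (Bl.card : ℝ) ≤ σ * (u (2 ^ (2 * N + 1)) - u (2 ^ (2 * N))) := by
    have h1 : Bl.card ≤ 2 ^ (2 * N) := by
      rw [hBl, Nat.card_Ico, show 2 * N + 1 - j = (2 * N - j) + 1 by omega, pow_succ]
      have : 2 ^ (2 * N - j) ≤ 2 ^ (2 * N) := Nat.pow_le_pow_right (by norm_num) (by omega)
      omega
    have h2 : (N:ℝ) * 2 ^ (2 * N) ≤ H * (u (2 ^ (2 * N + 1)) - u (2 ^ (2 * N))) := by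
      rw [← tele u _ _ (Nat.pow_le_pow_right (by norm_num) (Nat.le_succ _)), Finset.mul_sum]
      calc _ = ∑ k ∈ Finset.Ico (2 ^ (2 * N)) (2 ^ (2 * N + 1)), (N:ℝ) := by
            rw [Finset.sum_const, Nat.card_Ico, nsmul_eq_mul,
              show 2 ^ (2 * N + 1) - 2 ^ (2 * N) = 2 ^ (2 * N) by rw [pow_succ]; omega]
            push_cast; ring
        _ ≤ _ := Finset.sum_le_sum hH
    have h3 : (Bl.card : ℝ) ≤ 2 ^ (2 * N) := by exact_mod_cast h1
    refine h3.trans ?_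
    rw [← hσN] at h2
    nlinarith
  calc _ ≤ ((Bl.biUnion fun b => Finset.Icc ⌈σ * (Zc u (2 * N) j t b - (B + 2) * Dl u j b)⌉
        ⌊σ * (Zc u (2 * N) j t b + B * Dl u j b)⌋).card : ℝ) := by
        exact_mod_cast Finset.card_le_card hsub
    _ ≤ ∑ b ∈ Bl, ((Finset.Icc ⌈σ * (Zc u (2 * N) j t b - (B + 2) * Dl u j b)⌉
        ⌊σ * (Zc u (2 * N) j t b + B * Dl u j b)⌋).card : ℝ) := by
        exact_mod_cast Finset.card_biUnion_le
    _ ≤ ∑ b ∈ Bl, (σ * (2 * B + 2) * Dl u j b + 1) := by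
        apply Finset.sum_le_sum
        intro b _
        have hD := Dl_nonneg hm j b
        refine (card_Icc_le _ _ ?_).trans (le_of_eq (by ring))
        gcongr
        nlinarith
    _ = σ * (2 * B + 2) * (u (2 ^ (2 * N + 1)) - u (2 ^ (2 * N))) + Bl.card := by
        rw [Finset.sum_add_distrib, ← Finset.mul_sum, hL]; simp
    _ ≤ _ := by linarith

lemma EE_card {u : ℕ → ℝ} (hm : StrictMono u) {B : ℝ} (hB : 0 < B) (hP : PFB u B) (N H : ℕ)
    (hN : 1 ≤ N) (hH0 : 1 ≤ H)
    (hH : ∀ k ∈ Finset.Ico (2 ^ (2 * N)) (2 ^ (2 * N + 1)), (N:ℝ) + 2 ≤ H * (u (k + 1) - u k)) :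
    N * ((EE u N H).card : ℝ) ≤ (4 * B + 6) * (WW u N H).card := by
  have hNr : (0:ℝ) < N := by exact_mod_cast hN
  have hW := WW_card hm N H (fun k hk => by linarith [hH k hk])
  have hE : ((EE u N H).card : ℝ) ≤ H * ((2 * B + 3) * (H / N) * (u (2 ^ (2 * N + 1)) - u (2 ^ (2 * N)))) := by
    unfold EE
    rw [card_rowsF]; push_cast
    calc _ ≤ ∑ y ∈ (Finset.Ico (-(2 * H : ℤ)) (-(H:ℤ))), ((2 * B + 3) * (H / N) * (u (2 ^ (2 * N + 1)) - u (2 ^ (2 * N)))) := by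
          apply Finset.sum_le_sum
          intro Y hY
          rw [Finset.mem_Ico] at hY
          exact EE_row hm hB hP N H hN hH0 (fun k hk => by linarith [hH k hk]) Y hY.1 hY.2
      _ = _ := by
          rw [Finset.sum_const, nsmul_eq_mul, Int.card_Ico]
          have : (-(H:ℤ) - -(2 * H : ℤ)).toNat = H := by omega
          rw [this]
  calc _ ≤ N * (H * ((2 * B + 3) * (H / N) * (u (2 ^ (2 * N + 1)) - u (2 ^ (2 * N))))) := by gcongr
    _ = (4 * B + 6) * (H * (H * (u (2 ^ (2 * N + 1)) - u (2 ^ (2 * N))) / 2)) := by field_simp; ring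
    _ ≤ _ := by gcongr

lemma exists_H {u : ℕ → ℝ} (hm : StrictMono u) (M : ℕ) : ∃ H : ℕ, 1 ≤ H ∧
    ∀ k < 2 ^ (M + 1), ((M:ℝ) + 4) * √(1 + u k ^ 2) ≤ H * (u (k + 1) - u k) := by
  have h : ∀ n : ℕ, ∃ H : ℕ, 1 ≤ H ∧
    ∀ k < n, ((M:ℝ) + 4) * √(1 + u k ^ 2) ≤ H * (u (k + 1) - u k) := by
    intro n
    induction n with
    | zero => exact ⟨1, le_rfl, by simp⟩
    | succ n ih =>
      obtain ⟨H, h1, h2⟩ := ih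
      have hl : ∀ k, 0 < u (k + 1) - u k := fun k => sub_pos.2 (hm (by omega))
      obtain ⟨G, hG⟩ := exists_nat_ge (((M:ℝ) + 4) * √(1 + u n ^ 2) / (u (n + 1) - u n))
      rw [div_le_iff₀ (hl n)] at hG
      refine ⟨H + G, by omega, ?_⟩
      intro k hk
      push_cast
      have a1 : 0 ≤ (H:ℝ) * (u (k + 1) - u k) := mul_nonneg (by positivity) (hl k).le
      have a2 : 0 ≤ (G:ℝ) * (u (k + 1) - u k) := mul_nonneg (by positivity) (hl k).le
      rcases Nat.lt_succ_iff_lt_or_eq.1 hk with h | h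
      · linarith [h2 k h]
      · subst h; linarith
  exact h _

end Aux2
/-- under hypotheses (i) and (ii) on the sequence `u`, there is a
collection of rectangles `{R_k}` containing `(0,0)` with `l(R_k) → ∞`, the slope of
`R_k` being `1/u_k`, whose discrete maximal operator `A*` fails the Tauberian
condition. -/
theorem stmt12 (u : ℕ → ℝ) (hu0 : u 0 = 0) (hmono : StrictMono u)
    (hgap : ∃ c : ℝ, 0 < c ∧ ∀ k : ℕ, c * (u (k + 1) - u k) ^ 2 ≤ 1 + u k ^ 2)
    (hPF : ∃ B : ℝ, ∀ n l : ℕ, 1 ≤ l → l ≤ n →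
      (u (n + 2 * l) - u (n + l)) / (u (n + l) - u n) +
        (u (n + l) - u n) / (u (n + 2 * l) - u (n + l)) ≤ B) :
    ∃ R : ℕ → Rect, IsProcess R ∧
      (∀ k : ℕ, 1 ≤ k → (R k).slope = 1 / u k) ∧
      ¬ DiscTauberian R := by
  obtain ⟨c, hc, hgap⟩ := hgap
  obtain ⟨B₀, hPF⟩ := hPF
  have hP : PFB u (|B₀| + 1) := fun n l h1 h2 => (hPF n l h1 h2).trans (by linarith [le_abs_self B₀])
  have hB : 0 < |B₀| + 1 := by positivity
  generalize |B₀| + 1 = B at hP hB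
  choose H hH1 hH2 using exists_H hmono
  have hu : ∀ k, 0 ≤ u k := fun k => hu0 ▸ hmono.monotone (Nat.zero_le k)
  have hl : ∀ k, 0 < u (k + 1) - u k := fun k => sub_pos.2 (hmono (by omega))
  obtain ⟨C, hC⟩ : ∃ C : ℝ, C = 1 + 1 / c := ⟨_, rfl⟩
  have hC0 : 0 ≤ C := by rw [hC]; positivity
  have hgap' : ∀ k, (u (k + 1) - u k) ^ 2 ≤ (C - 1) * (1 + u k ^ 2) := by
    intro k
    have := hgap k
    rw [hC, add_sub_cancel_left, one_div_mul_eq_div, le_div_iff₀ hc]; linarith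
  have hul : ∀ k, u k * (u (k + 1) - u k) ≤ C * (1 + u k ^ 2) := by
    intro k
    nlinarith [hgap' k, sq_nonneg (u k - (u (k + 1) - u k)), sq_nonneg (u k), sq_nonneg (u (k + 1) - u k)]
  have hlK : ∀ k, (u (k + 1) - u k) ≤ (C + 4) * (1 + u k ^ 2) := by
    intro k
    nlinarith [hgap' k, sq_nonneg (1 - (u (k + 1) - u k)), sq_nonneg (u k), sq_nonneg (u (k + 1) - u k)]
  have hK : 0 < C + 4 := by positivity
  have hHp : ∀ M, 0 < (H M : ℝ) := fun M => by exact_mod_cast hH1 M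
  have hq1 : ∀ k, 1 ≤ √(1 + u k ^ 2) := fun k => Real.one_le_sqrt.2 (by nlinarith [sq_nonneg (u k)])
  refine ⟨fun k => mkR (u k) (u (k + 1) - u k) (C + 4) (H (Nat.log 2 k)) (hl k) hK (hHp _), ⟨?_, ?_⟩, ?_, ?_⟩
  · intro k; exact mkR_zero _ _ _ _ _ _ _
  · have hlog : Tendsto (fun k : ℕ => (Nat.log 2 k : ℝ)) atTop atTop := by
      apply tendsto_natCast_atTop_atTop.comp
      apply tendsto_atTop.2
      intro b
      filter_upwards [eventually_ge_atTop (2 ^ b)] with k hk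
      exact Nat.le_log_of_pow_le (by norm_num) hk
    refine tendsto_atTop_mono (fun k => ?_) hlog
    apply mkR_short _ _ _ _ _ _ _ (hlK k)
    refine le_trans ?_ (hH2 (Nat.log 2 k) k (Nat.lt_pow_succ_log_self (by norm_num) k))
    gcongr; linarith
  · intro k _; exact mkR_slope _ _ _ _ _ _ _ (hlK k)
  · intro hT
    obtain ⟨D, hD, hT⟩ := hT (1 / (30 * (C + 4))) (by positivity)
    obtain ⟨N, hN⟩ := exists_nat_gt (D * (4 * B + 6))
    have hN1 : 1 ≤ N := by
      rcases Nat.eq_zero_or_pos N with h | h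
      · subst h
        have : 0 < D * (4 * B + 6) := by positivity
        simp at hN; linarith
      · exact h
    have hbig : ∀ k ∈ Finset.Ico (2 ^ (2 * N)) (2 ^ (2 * N + 1)),
        (N:ℝ) + 2 ≤ H (2 * N) * (u (k + 1) - u k) := by
      intro k hk
      rw [Finset.mem_Ico] at hk
      have := hH2 (2 * N) k hk.2
      push_cast at this
      have h1 := hq1 k
      have hN0 : (0:ℝ) ≤ N := by positivity
      nlinarith
    have hcard := EE_card hmono hB hP N (H (2 * N)) hN1 (hH1 _) hbig
    have hEmem : ∀ k ∈ Finset.Ico (2 ^ (2 * N)) (2 ^ (2 * N + 1)), ∀ X Y : ℤ,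
        -(2 * H (2 * N) : ℤ) ≤ Y → Y < -(H (2 * N):ℤ) →
        (H (2 * N) / N : ℝ) * aOff u (2 * N) k + u k * Y ≤ X →
        X ≤ (H (2 * N) / N : ℝ) * aOff u (2 * N) k + u k * Y + H (2 * N) * (u (k + 1) - u k) →
        (X, Y) ∈ EE u N (H (2 * N)) := by
      intro k hk X Y h1 h2 h3 h4
      unfold EE
      rw [mem_rowsF]
      refine ⟨Finset.mem_Ico.2 ⟨h1, h2⟩, Finset.mem_biUnion.2 ⟨k, hk, ?_⟩⟩
      rw [Finset.mem_Icc, Int.ceil_le, Int.le_floor]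
      exact ⟨h3, h4⟩
    have hne : (EE u N (H (2 * N))).Nonempty := by
      have hk : 2 ^ (2 * N) ∈ Finset.Ico (2 ^ (2 * N)) (2 ^ (2 * N + 1)) :=
        Finset.mem_Ico.2 ⟨le_rfl, Nat.pow_lt_pow_right (by norm_num) (by omega)⟩
      have hp := hH1 (2 * N)
      refine ⟨_, hEmem (2 ^ (2 * N)) hk ⌈(H (2 * N) / N : ℝ) * aOff u (2 * N) (2 ^ (2 * N)) + u (2 ^ (2 * N)) * (-(2 * H (2 * N) : ℤ) : ℤ)⌉ (-(2 * H (2 * N) : ℤ)) le_rfl (by omega) (Int.le_ceil _) ?_⟩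
      refine (Int.ceil_lt_add_one _).le.trans ?_
      have h1 := hbig _ hk
      have hN0 : (0:ℝ) ≤ N := by positivity
      gcongr
      linarith
    have h := hT _ hne
    have hsub : (WW u N (H (2 * N)) : Set (ℤ × ℤ)) ⊆ {kl : ℤ × ℤ |
        ENNReal.ofReal (1 / (30 * (C + 4))) ≤ discMaxOp (fun k => mkR (u k) (u (k + 1) - u k) (C + 4) (H (Nat.log 2 k)) (hl k) hK (hHp _)) (fun q => if q ∈ EE u N (H (2 * N)) then (1 : ℝ) else 0) kl} := by
      rintro ⟨X, Y⟩ hXY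
      rw [Finset.mem_coe] at hXY
      unfold WW at hXY
      rw [mem_rowsF] at hXY
      obtain ⟨hY, hX⟩ := hXY
      obtain ⟨k, hk, hX⟩ := Finset.mem_biUnion.1 hX
      rw [Finset.mem_Ico, Int.ceil_le, Int.lt_ceil] at hX
      rw [Finset.mem_Ico] at hY
      have hlogk : Nat.log 2 k = 2 * N := by
        rw [Finset.mem_Ico] at hk
        exact Nat.log_eq_of_pow_le_of_lt_pow hk.1 hk.2
      have := avg_mkR (u k) (u (k + 1) - u k) (C + 4) C (H (2 * N)) (hl k) hK (hHp _) hC0 (hul k) (hu k) le_rfl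
        (by have := hbig k hk
            have hN0 : (0:ℝ) ≤ N := by positivity
            linarith) (EE u N (H (2 * N))) _ (hEmem k hk) X Y hY.1 hY.2 hX.1 hX.2.le
      rw [mem_ofPred_eq]
      unfold discMaxOp
      refine le_trans ?_ (le_iSup _ k)
      apply ENNReal.ofReal_le_ofReal
      simp only [hlogk]
      exact this
    have h2 := (measure_mono hsub).trans h
    rw [Measure.count_apply_finset] at h2
    have h3 : ((WW u N (H (2 * N))).card : ℝ) ≤ D * (EE u N (H (2 * N))).card := by
      rw [← ENNReal.ofReal_natCast, ← ENNReal.ofReal_natCast, ← ENNReal.ofReal_mul hD.le] at h2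
      rwa [ENNReal.ofReal_le_ofReal_iff (by positivity)] at h2
    have hEp : 0 < ((EE u N (H (2 * N))).card : ℝ) := by exact_mod_cast hne.card_pos
    have h4 : (4 * B + 6) * ((WW u N (H (2 * N))).card : ℝ) ≤ (4 * B + 6) * (D * (EE u N (H (2 * N))).card) := by
      gcongr
    have h5 := mul_lt_mul_of_pos_right hN hEp
    linarith

end
end
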